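/- arXiv:1805.03097 — 3 statements merged into one kernel-verified Lean document; each statement's English description precedes it below -/
import Mathlib

section
/- Let q be an odd prime power and let N_q be the number of permutation rational functions of degree 3 of the form f/g with f, g ∈ F_q[x] monic coprime polynomials. If 3 ∤ q, letting m ∈ {1, 2} be the residue class of q modulo 3, one has N_q = (1/2)(q⁴ + 2(m − 1)q³ + (2m − 3)q²). If 3 ∣ q, one has N_q = (1/2)(q⁴ + q³ + q² + q). -/
open Polynomial

noncomputable section

open scoped Classical in
/-- The self-map of `ℙ¹(F) = F ∪ {∞}` (encoded as `Option F`, with `none` = `∞`)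
induced by the rational function `f/g`, where `f, g` are coprime polynomials. -/
def ratEval {F : Type} [Field F] (f g : F[X]) : Option F → Option F := fun x =>
  match x with
  | some a => if g.eval a ≠ 0 then some (f.eval a / g.eval a) else none
  | none =>
      if g.natDegree < f.natDegree then none
      else if f.natDegree < g.natDegree then some 0
      else some (f.leadingCoeff / g.leadingCoeff)

/-- The set of pairs of monic coprime polynomials `(f, g)` with `max(deg f, deg g) = 3`
such that `f/g` is a permutation rational function. -/
def permPairs (F : Type) [Field F] : Set (F[X] × F[X]) :=
  {p | p.1.Monic ∧ p.2.Monic ∧ IsCoprime p.1 p.2 ∧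
    max p.1.natDegree p.2.natDegree = 3 ∧ Function.Bijective (ratEval p.1 p.2)}

section FieldFacts

variable {F : Type*} [Field F] [Fintype F]

lemma ringChar_ne_two_of_odd_card (hodd : Odd (Fintype.card F)) : ringChar F ≠ 2 := by
  intro h
  have := FiniteField.even_card_of_char_two h
  rcases hodd with ⟨k, hk⟩
  omega

lemma two_ne_zero_of_odd_card (hodd : Odd (Fintype.card F)) : (2 : F) ≠ 0 :=
  Ring.two_ne_zero (ringChar_ne_two_of_odd_card hodd)

lemma three_eq_zero_iff_dvd_card : (3 : F) = 0 ↔ 3 ∣ Fintype.card F := by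
  have : Fact (Nat.Prime 3) := ⟨Nat.prime_three⟩
  rw [← prime_dvd_char_iff_dvd_card 3]
  have h := ringChar.spec F 3
  rw [show ((3 : ℕ) : F) = 3 by norm_num] at h
  rw [h]
  constructor
  · intro h3
    rcases (Nat.dvd_prime Nat.prime_three).1 h3 with h1 | h1
    · exact absurd h1 CharP.ringChar_ne_one
    · rw [h1]
  · intro h3
    have : CharP F (ringChar F) := ringChar.charP F
    have hp : (ringChar F).Prime :=
      (CharP.char_is_prime_or_zero F (ringChar F)).resolve_right (CharP.char_ne_zero_of_finite F _)
    rw [(Nat.prime_dvd_prime_iff_eq Nat.prime_three hp).1 h3]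

lemma two_mul_card_nonsquares_add_one (hodd : Odd (Fintype.card F)) :
    2 * {d : F | ¬ IsSquare d}.ncard + 1 = Fintype.card F := by
  classical
  have hs := quadraticChar_sum_zero (ringChar_ne_two_of_odd_card hodd)
  have hpt : ∀ a : F, 2 * (if ¬ IsSquare a then (1 : ℤ) else 0) + (if a = 0 then 1 else 0)
      + quadraticChar F a = 1 := by
    intro a
    by_cases ha : a = 0
    · subst ha; simp
    · by_cases hsq : IsSquare a
      · simp [ha, hsq, (quadraticChar_one_iff_isSquare ha).2 hsq]
      · simp [ha, hsq, quadraticChar_neg_one_iff_not_isSquare.2 hsq]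
  have h2 : ∑ a : F, (2 * (if ¬ IsSquare a then (1 : ℤ) else 0) + (if a = 0 then 1 else 0)
      + quadraticChar F a) = Fintype.card F := by
    rw [Finset.sum_congr rfl fun a _ => hpt a]; simp
  rw [Finset.sum_add_distrib, Finset.sum_add_distrib, hs, ← Finset.mul_sum, Finset.sum_boole,
    Finset.sum_ite_eq' Finset.univ (0 : F) fun _ => (1 : ℤ)] at h2
  have h3 : {d : F | ¬ IsSquare d}.ncard = (Finset.univ.filter fun d : F => ¬ IsSquare d).card := by
    rw [← Set.ncard_coe_finset]; simp
  rw [h3]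
  simp only [Finset.mem_univ, if_true] at h2
  omega

/-- A nondegenerate quadratic polynomial without linear term takes a nonzero square value. -/
lemma exists_quadratic_eq_sq (hodd : Odd (Fintype.card F)) (h3 : (3 : F) ≠ 0) {α κ : F}
    (hα : α ≠ 0) (hκ : κ ≠ 0) : ∃ z w : F, w ≠ 0 ∧ α * z ^ 2 + κ = w ^ 2 := by
  have h2 := two_ne_zero_of_odd_card hodd
  by_cases hs : IsSquare α
  · obtain ⟨a, rfl⟩ := hs
    have ha : a ≠ 0 := by rintro rfl; simp at hα
    have key : ∀ t : F, t ≠ 0 → t ^ 2 + κ ≠ 0 →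
        ∃ z w : F, w ≠ 0 ∧ a * a * z ^ 2 + κ = w ^ 2 := by
      intro t ht htk
      refine ⟨(κ / t - t) / (2 * a), (t + κ / t) / 2, ?_, ?_⟩
      · have : (t + κ / t) / 2 = (t ^ 2 + κ) / (2 * t) := by field_simp
        rw [this]
        exact div_ne_zero htk (mul_ne_zero h2 ht)
      · field_simp
        ring
    by_cases h1 : (1 : F) ^ 2 + κ = 0
    · refine key 2 h2 fun h => h3 ?_
      linear_combination h - h1
    · exact key 1 one_ne_zero h1
  · obtain ⟨z, w, h⟩ : ∃ z w : F, α * z ^ 2 + κ = w ^ 2 := by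
      obtain ⟨z, w, h⟩ := FiniteField.exists_root_sum_quadratic
        (f := C α * X ^ 2 + C 0 * X + C κ) (g := C (-1) * X ^ 2 + C 0 * X + C 0)
        (degree_quadratic hα) (degree_quadratic (by simp))
        (Nat.odd_iff.1 hodd)
      refine ⟨z, w, ?_⟩
      simp at h
      linear_combination h
    by_cases hw : w = 0
    · subst hw
      have hz : z ≠ 0 := by rintro rfl; apply hκ; simpa using h
      have h1 : (1 : F) - α ≠ 0 := by
        intro h1
        exact hs ⟨1, by linear_combination -h1⟩
      refine ⟨(1 + α) / (1 - α) * z, α * (2 / (1 - α)) * z, by positivity, ?_⟩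
      field_simp
      linear_combination (1 - α) ^ 2 * h
    · exact ⟨z, w, hw, h⟩

/-- An injective monic cubic polynomial function is, up to a constant, the cube of a linear
polynomial (in characteristic three: is additive up to a constant). -/
lemma sq_eq_three_mul_of_cubic_injective (hodd : Odd (Fintype.card F)) {a b : F}
    (hinj : ∀ x y : F, x ^ 3 + a * x ^ 2 + b * x = y ^ 3 + a * y ^ 2 + b * y → x = y) :
    a ^ 2 = 3 * b := by
  have h2 := two_ne_zero_of_odd_card hodd
  -- if the residual quadratic at `z` has a nonzero square discriminant, injectivity fails
  have hdisc : ∀ z w : F, w ≠ 0 → -3 * z ^ 2 - 2 * a * z + a ^ 2 - 4 * b ≠ w ^ 2 := by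
    intro z w hw h
    have key : ∀ v : F, v ^ 2 = w ^ 2 → z = (-(z + a) + v) / 2 := by
      intro v hv
      apply hinj
      field_simp
      linear_combination (3 * z + a - v) * (hv - h)
    have e1 := key w rfl
    have e2 := key (-w) (by ring)
    apply hw
    field_simp at e1 e2
    have : 2 * w = 0 := by linear_combination e2 - e1
    exact (mul_eq_zero.1 this).resolve_left h2
  by_cases h3 : (3 : F) = 0
  · rw [h3, zero_mul]
    by_contra ha
    have ha : a ≠ 0 := by rintro rfl; simp at ha
    refine hdisc ((a ^ 2 - 4 * b - 1) / (2 * a)) 1 one_ne_zero ?_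
    rw [h3]
    field_simp
    ring
  · by_contra hne
    have h4 : (4 : F) ≠ 0 := by
      rw [show (4 : F) = 2 * 2 by norm_num]; exact mul_ne_zero h2 h2
    obtain ⟨z, w, hw, h⟩ := exists_quadratic_eq_sq hodd h3 (α := -3)
      (κ := 4 * (a ^ 2 - 3 * b) / 3) (neg_ne_zero.2 h3)
      (div_ne_zero (mul_ne_zero h4 (sub_ne_zero.2 hne)) h3)
    refine hdisc (z - a / 3) w hw ?_
    rw [← h]
    field_simp
    ring

lemma cube_injective_of_card_mod_three (h : Fintype.card F % 3 = 2) {x y : F}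
    (hxy : x ^ 3 = y ^ 3) : x = y := by
  have key : ∀ z : F, (z ^ 3) ^ ((2 * Fintype.card F - 1) / 3) = z := by
    intro z
    rw [← pow_mul, show 3 * ((2 * Fintype.card F - 1) / 3)
      = Fintype.card F + (Fintype.card F - 1) by omega, pow_add, FiniteField.pow_card]
    by_cases hz : z = 0
    · rw [hz, zero_mul]
    · rw [FiniteField.pow_card_sub_one_eq_one z hz, mul_one]
  rw [← key x, hxy, key]

lemma exists_cube_eq_one_of_card_mod_three (h : Fintype.card F % 3 = 1) :
    ∃ w : F, w ≠ 1 ∧ w ^ 3 = 1 := by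
  classical
  have : Fact (Nat.Prime 3) := ⟨Nat.prime_three⟩
  have hc : 3 ∣ Fintype.card Fˣ := by
    rw [Fintype.card_units]; omega
  obtain ⟨u, hu⟩ := exists_prime_orderOf_dvd_card 3 hc
  refine ⟨u, ?_, ?_⟩
  · intro h1
    rw [Units.val_eq_one.1 h1, orderOf_one] at hu
    omega
  · rw [← Units.val_pow_eq_pow_val, ← hu, pow_orderOf_eq_one, Units.val_one]

end FieldFacts

section NonsquareQuartic

variable {F : Type*} [Field F] [Fintype F]

lemma X_pow_card_sub_X_dvd {P : F[X]} (h : ∀ z, P.eval z = 0) : X ^ Fintype.card F - X ∣ P := by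
  have hW : (X ^ Fintype.card F - X : F[X]).Monic :=
    monic_X_pow_sub (by simpa using Fintype.one_lt_card (α := F))
  rw [← modByMonic_eq_zero_iff_dvd hW]
  refine eq_zero_of_natDegree_lt_card_of_eval_eq_zero _ Function.injective_id (fun z => ?_) ?_
  · have := congrArg (eval z) (modByMonic_add_div P (X ^ Fintype.card F - X))
    simpa [h z, FiniteField.pow_card] using this
  · refine (natDegree_modByMonic_lt P hW fun h1 => ?_).trans_eq
      (FiniteField.X_pow_card_sub_X_natDegree_eq F Fintype.one_lt_card)
    have := FiniteField.X_pow_card_sub_X_natDegree_eq F (Fintype.one_lt_card (α := F))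
    rw [h1, natDegree_one] at this
    exact Fintype.card_ne_zero this.symm

/-- If a quartic polynomial takes only nonsquare values on a finite field with at least seven
elements, then its logarithmic derivative is twice that of a quadratic polynomial. -/
lemma exists_quadratic_two_mul_derivative_eq (hodd : Odd (Fintype.card F))
    (hq : 7 ≤ Fintype.card F) {D : F[X]} (hdeg : D.natDegree = 4)
    (hD : ∀ z, ¬ IsSquare (D.eval z)) :
    ∃ K : F[X], K.natDegree = 2 ∧ 2 * D * derivative K = derivative D * K := by
  have h2 := two_ne_zero_of_odd_card hodd
  have hD0 : D ≠ 0 := by rintro rfl; simp at hdeg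
  obtain ⟨n, hn⟩ := id hodd
  set W : F[X] := X ^ Fintype.card F - X with hW
  have hWdeg : W.natDegree = Fintype.card F :=
    FiniteField.X_pow_card_sub_X_natDegree_eq F Fintype.one_lt_card
  have hW0 : W ≠ 0 := FiniteField.X_pow_card_sub_X_ne_zero F Fintype.one_lt_card
  have hW' : derivative W = -1 := by
    rw [hW, derivative_sub, derivative_X_pow, FiniteField.cast_card_eq_zero]
    simp
  have hnF : (2 * (n : F[X]) + 1) = 0 := by
    have : ((Fintype.card F : ℕ) : F) = 0 := FiniteField.cast_card_eq_zero F
    rw [hn] at this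
    have := congrArg (C : F →+* F[X]) this
    rw [map_natCast, map_zero] at this
    exact_mod_cast this
  obtain ⟨h, hh⟩ : W ∣ D ^ n + 1 := by
    refine X_pow_card_sub_X_dvd fun z => ?_
    have hz : D.eval z ≠ 0 := fun h0 => hD z (h0 ▸ IsSquare.zero)
    have hdich := FiniteField.pow_dichotomy (ringChar_ne_two_of_odd_card hodd) hz
    have hsq := FiniteField.isSquare_iff (ringChar_ne_two_of_odd_card hodd) hz
    rw [show Fintype.card F / 2 = n by omega] at hdich hsq
    have := hdich.resolve_left fun h1 => hD z (hsq.2 h1)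
    simp [this]
  have hpow : (D ^ n + 1).natDegree = 4 * n := by
    rw [← C_1, natDegree_add_C, natDegree_pow, hdeg, mul_comm]
  have hh0 : h ≠ 0 := by
    rintro rfl
    rw [hh, mul_zero, natDegree_zero] at hpow
    omega
  have hhdeg : h.natDegree + Fintype.card F = 4 * n := by
    rw [← hpow, hh, natDegree_mul hW0 hh0, hWdeg, add_comm]
  have hder : derivative (D ^ n) = -h + W * derivative h := by
    have := congrArg derivative hh
    rw [derivative_add, derivative_one, add_zero, derivative_mul, hW'] at this
    rw [this]; ring
  have hlog : 2 * D * derivative (D ^ n) = -derivative D * D ^ n := by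
    have hn0 : n ≠ 0 := by omega
    rw [derivative_pow, C_eq_natCast]
    have : D ^ n = D ^ (n - 1) * D := by rw [← pow_succ, Nat.sub_add_cancel (by omega)]
    rw [this]
    linear_combination (D ^ (n - 1) * D * derivative D) * hnF
  set K : F[X] := 2 * D * derivative h + derivative D * h with hK
  have hWK : W * K = 2 * D * h + derivative D := by
    rw [hK]
    linear_combination hlog - 2 * D * hder - derivative D * hh
  have h2D : (2 * D * h).natDegree = 4 + h.natDegree := by
    rw [show (2 : F[X]) = C 2 from rfl, mul_assoc, natDegree_C_mul h2, natDegree_mul hD0 hh0, hdeg]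
  have hD'deg : (derivative D).natDegree < 4 := by
    have := natDegree_derivative_lt (p := D) (by omega)
    omega
  have hKdeg : K.natDegree = 2 := by
    have hs : (W * K).natDegree = 4 + h.natDegree := by
      rw [hWK, natDegree_add_eq_left_of_natDegree_lt (by omega), h2D]
    have hK0 : K ≠ 0 := by
      intro h0; rw [h0, mul_zero, natDegree_zero] at hs; omega
    rw [natDegree_mul hW0 hK0, hWdeg] at hs
    omega
  refine ⟨K, hKdeg, ?_⟩
  have hKder : -2 * K + W * derivative K = derivative D * h + derivative (derivative D) := by
    have := congrArg derivative hWK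
    simp only [derivative_mul, derivative_add, hW', derivative_ofNat] at this
    linear_combination this + hK
  have hmain : W * (2 * D * derivative K - derivative D * K)
      = 4 * D * K - derivative D ^ 2 + 2 * D * derivative (derivative D) := by
    linear_combination 2 * D * hKder - derivative D * hWK
  have hzero : 4 * D * K - derivative D ^ 2 + 2 * D * derivative (derivative D) = 0 := by
    refine eq_zero_of_dvd_of_natDegree_lt (Dvd.intro _ hmain) ?_
    have : (4 * D * K - derivative D ^ 2 + 2 * D * derivative (derivative D)).natDegree ≤ 6 := by
      have hD'' := natDegree_derivative_le (derivative D)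
      have h4 : (4 * D * K).natDegree ≤ 6 := by
        rw [show (4 : F[X]) = C 4 from rfl, mul_assoc]
        exact (natDegree_C_mul_le _ _).trans (natDegree_mul_le.trans (by omega))
      have hsq : (derivative D ^ 2).natDegree ≤ 6 := natDegree_pow_le.trans (by omega)
      have h2D'' : (2 * D * derivative (derivative D)).natDegree ≤ 6 := by
        rw [show (2 : F[X]) = C 2 from rfl, mul_assoc]
        exact (natDegree_C_mul_le _ _).trans (natDegree_mul_le.trans (by omega))
      exact natDegree_add_le_of_degree_le (natDegree_sub_le_of_le h4 hsq) h2D''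
    omega
  rw [hzero] at hmain
  exact sub_eq_zero.1 ((mul_eq_zero.1 hmain).resolve_left hW0)

/-- A quartic polynomial which takes only nonsquare values on a finite field with at least seven
elements is a constant multiple of the square of a quadratic polynomial. -/
lemma quartic_eq_mul_sq_of_not_isSquare (hodd : Odd (Fintype.card F))
    (hq : 7 ≤ Fintype.card F) {A a₃ a₂ a₁ a₀ : F} (hA : A ≠ 0)
    (hD : ∀ z, ¬ IsSquare (A * z ^ 4 + a₃ * z ^ 3 + a₂ * z ^ 2 + a₁ * z + a₀)) :
    ∃ k₁ k₀ : F, a₃ = 2 * A * k₁ ∧ a₂ = A * (2 * k₀ + k₁ ^ 2) ∧ a₁ = 2 * A * k₁ * k₀ ∧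
      a₀ = A * k₀ ^ 2 := by
  have h2 := two_ne_zero_of_odd_card hodd
  obtain ⟨K, hKdeg, hK⟩ := exists_quadratic_two_mul_derivative_eq hodd hq
    (D := C A * X ^ 4 + C a₃ * X ^ 3 + C a₂ * X ^ 2 + C a₁ * X + C a₀)
    (by compute_degree!) (by simpa using hD)
  have hl : K.coeff 2 ≠ 0 := by
    rw [← hKdeg, coeff_natDegree, leadingCoeff_ne_zero]
    rintro rfl
    simp at hKdeg
  have hKeq := eq_quadratic_of_degree_le_two (natDegree_le_iff_degree_le.1 hKdeg.le)
  generalize K.coeff 2 = l at *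
  generalize K.coeff 1 = m at *
  generalize K.coeff 0 = n at *
  rw [hKeq] at hK
  simp only [derivative_add, derivative_mul, derivative_C, derivative_X_pow, derivative_X,
    zero_mul, zero_add, mul_one, add_zero] at hK
  have hpoly : C (2 * A * m - a₃ * l) * X ^ 4 + C (4 * A * n + a₃ * m - 2 * a₂ * l) * X ^ 3
      + C (3 * a₃ * n - 3 * a₁ * l) * X ^ 2 + C (2 * a₂ * n - a₁ * m - 4 * a₀ * l) * X
      + C (a₁ * n - 2 * a₀ * m) = (0 : F[X]) := by
    simp only [map_sub, map_add, map_mul, map_ofNat]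
    push_cast at hK
    simp only [map_ofNat] at hK
    linear_combination -hK
  have c4 := congrArg (coeff · 4) hpoly
  have c3 := congrArg (coeff · 3) hpoly
  have c2 := congrArg (coeff · 2) hpoly
  have c1 := congrArg (coeff · 1) hpoly
  have c0 := congrArg (coeff · 0) hpoly
  simp [coeff_X, coeff_C, -map_sub, -map_add, -map_mul] at c4 c3 c2 c1 c0
  obtain ⟨r, rfl⟩ : ∃ r, m = r * l := ⟨m / l, by field_simp⟩
  obtain ⟨s, rfl⟩ : ∃ s, n = s * l := ⟨n / l, by field_simp⟩
  have e3 : a₃ = 2 * A * r := mul_right_cancel₀ hl (by linear_combination -c4)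
  have e2 : a₂ = A * (2 * s + r ^ 2) := by
    refine mul_right_cancel₀ (mul_ne_zero h2 hl) ?_
    linear_combination -c3 + r * l * e3
  have e0 : 4 * a₀ = 4 * A * s ^ 2 - (a₁ - 2 * A * r * s) * r := by
    refine mul_right_cancel₀ hl ?_
    linear_combination -c1 + 2 * s * l * e2
  have he3 : 3 * (a₁ - 2 * A * r * s) = 0 := by
    refine (mul_eq_zero.1 ?_).resolve_right hl
    linear_combination -c2 + 3 * s * l * e3
  have he : (a₁ - 2 * A * r * s) * (2 * s + r ^ 2) = 0 := by
    refine (mul_eq_zero.1 ?_).resolve_right hl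
    linear_combination 2 * c0 + r * l * e0
  have h4 : (4 : F) ≠ 0 := by
    rw [show (4 : F) = 2 * 2 by norm_num]; exact mul_ne_zero h2 h2
  have e1 : a₁ - 2 * A * r * s = 0 := by
    by_contra hne
    have h3 := (mul_eq_zero.1 he3).resolve_right hne
    have hs := (mul_eq_zero.1 he).resolve_left hne
    refine hD r ?_
    have hs' : s = r ^ 2 := by linear_combination s * h3 - hs
    have h0 : 4 * (A * r ^ 4 + a₃ * r ^ 3 + a₂ * r ^ 2 + a₁ * r + a₀) = 0 := by
      rw [e3, e2]
      subst hs'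
      linear_combination e0 + (12 * A * r ^ 4 + (a₁ - 2 * A * r * r ^ 2) * r) * h3
    rw [(mul_eq_zero.1 h0).resolve_left h4]
    exact IsSquare.zero
  refine ⟨r, s, e3, e2, sub_eq_zero.1 e1, mul_left_cancel₀ h4 ?_⟩
  linear_combination e0 - r * e1

end NonsquareQuartic

section NonsplitDenominator

lemma nonsplit_classification_zmod_three : ∀ d B c : ZMod 3, (∀ z, z * z ≠ d) →
    (∀ x y : ZMod 3, (x ^ 2 - d) * (y ^ 2 - d) = B * (x * y + d) + c * (x + y) → x = y) →
    (B = 0 ∧ c = 0) ∨ (B = -8 * d ∧ c = 0) := by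
  decide

set_option maxRecDepth 10000 in
lemma nonsplit_classification_zmod_five : ∀ d B c : ZMod 5, (∀ z, z * z ≠ d) →
    (∀ x y : ZMod 5, (x ^ 2 - d) * (y ^ 2 - d) = B * (x * y + d) + c * (x + y) → x = y) →
    (B = 0 ∧ c = 0) ∨ (B = -8 * d ∧ c = 0) := by
  decide

lemma nonsplit_classification_of_ringEquiv {R F : Type*} [CommRing R] [Field F] (e : R ≃+* F)
    (h : ∀ d B c : R, (∀ z, z * z ≠ d) →
      (∀ x y : R, (x ^ 2 - d) * (y ^ 2 - d) = B * (x * y + d) + c * (x + y) → x = y) →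
      (B = 0 ∧ c = 0) ∨ (B = -8 * d ∧ c = 0)) {d B c : F} (hd : ¬ IsSquare d)
    (hinj : ∀ x y : F, (x ^ 2 - d) * (y ^ 2 - d) = B * (x * y + d) + c * (x + y) → x = y) :
    (B = 0 ∧ c = 0) ∨ (B = -8 * d ∧ c = 0) := by
  obtain ⟨d, rfl⟩ := e.surjective d
  obtain ⟨B, rfl⟩ := e.surjective B
  obtain ⟨c, rfl⟩ := e.surjective c
  have := h d B c (fun z hz => hd ⟨e z, by rw [← hz, map_mul]⟩) fun x y hxy =>
    e.injective (hinj _ _ (by simpa using congrArg e hxy))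
  rcases this with ⟨rfl, rfl⟩ | ⟨rfl, rfl⟩
  · simp
  · right; simp [map_ofNat e 8]

variable {F : Type*} [Field F] [Fintype F]

/-- The curve `φ(x) = φ(y)`, `x ≠ y`, for `φ = x + (B x + c) / (x ^ 2 - d)` with `d` a nonsquare,
has no rational points off the diagonal only for a single nonconstant `B x + c`. -/
lemma nonsplit_classification (hodd : Odd (Fintype.card F)) {d B c : F} (hd : ¬ IsSquare d)
    (hinj : ∀ x y : F, (x ^ 2 - d) * (y ^ 2 - d) = B * (x * y + d) + c * (x + y) → x = y) :
    (B = 0 ∧ c = 0) ∨ (B = -8 * d ∧ c = 0) := by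
  have h2 := two_ne_zero_of_odd_card hodd
  have h4 : (4 : F) ≠ 0 := by
    rw [show (4 : F) = 2 * 2 by norm_num]; exact mul_ne_zero h2 h2
  have hd0 : d ≠ 0 := by rintro rfl; exact hd IsSquare.zero
  have hgd : ∀ x : F, x ^ 2 - d ≠ 0 := fun x hx => hd ⟨x, by linear_combination -hx⟩
  -- a root of the residual quadratic at `z` must be `z` itself
  have hroot : ∀ z w : F, w ^ 2 = (B * z + c) ^ 2 +
      4 * (z ^ 2 - d) * (d * (z ^ 2 - d) + B * d + c * z) →
      2 * z * (z ^ 2 - d) = B * z + c + w := by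
    intro z w h
    have hz := hgd z
    have : z = (B * z + c + w) / (2 * (z ^ 2 - d)) := by
      apply hinj
      field_simp
      linear_combination h
    field_simp at this
    linear_combination this
  by_cases hzero : ∃ r, (B * r + c) ^ 2 +
      4 * (r ^ 2 - d) * (d * (r ^ 2 - d) + B * d + c * r) = 0
  · obtain ⟨r, hr⟩ := hzero
    have e1 := hroot r 0 (by rw [hr]; ring)
    have hgr := hgd r
    have e2 : B * d + c * r = -(r ^ 2 + d) * (r ^ 2 - d) := by
      refine mul_left_cancel₀ (mul_ne_zero h4 hgr) ?_
      linear_combination hr + (2 * r * (r ^ 2 - d) + B * r + c) * e1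
    have eB : B = 3 * r ^ 2 + d := by
      refine mul_left_cancel₀ hgr ?_
      linear_combination -r * e1 - e2
    have ec : c = -r ^ 3 - 3 * r * d := by
      linear_combination -e1 - r * eB
    -- now `φ(x) - φ(r) = (x - r) ^ 3 / (x ^ 2 - d)`
    have hcub : (2 * r / (r ^ 2 - d)) ^ 2 = 3 * (1 / (r ^ 2 - d)) := by
      have hne : ∀ v : F, v ≠ 0 → v ^ 3 + 2 * r / (r ^ 2 - d) * v ^ 2
          + 1 / (r ^ 2 - d) * v ≠ 0 := by
        intro v hv h
        have h' : v * ((r ^ 2 - d) * v ^ 2 + 2 * r * v + 1) = 0 := by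
          field_simp at h
          linear_combination h
        apply hgd (r + 1 / v)
        field_simp
        linear_combination (mul_eq_zero.1 h').resolve_left hv
      refine sq_eq_three_mul_of_cubic_injective hodd fun u v huv => ?_
      by_cases hu : u = 0
      · subst hu
        by_contra hv
        exact hne v (Ne.symm hv) (by linear_combination -huv)
      by_cases hv : v = 0
      · subst hv
        exact absurd (by linear_combination huv) (hne u hu)
      have : r + 1 / u = r + 1 / v := by
        by_contra huv'
        apply huv'
        apply hinj
        have hne' : u - v ≠ 0 := sub_ne_zero.2 fun h => huv' (by rw [h])
        have hfac : (u - v) * ((r ^ 2 - d) * (u ^ 2 + u * v + v ^ 2) + 2 * r * (u + v) + 1) = 0 := by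
          field_simp at huv
          linear_combination huv
        rw [eB, ec]
        field_simp
        linear_combination (mul_eq_zero.1 hfac).resolve_left hne'
      simpa using this
    have hrd : r ^ 2 = -3 * d := by
      field_simp at hcub
      linear_combination hcub
    right
    refine ⟨by linear_combination eB + 3 * hrd, ?_⟩
    rw [ec]; linear_combination -r * hrd
  · push Not at hzero
    have hns : ∀ z : F, ¬ IsSquare (4 * d * z ^ 4 + 4 * c * z ^ 3 +
        (B ^ 2 + 4 * B * d - 8 * d ^ 2) * z ^ 2 + (2 * B * c - 4 * c * d) * z +
        (c ^ 2 + 4 * d ^ 3 - 4 * B * d ^ 2)) := by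
      rintro z ⟨w, hw⟩
      have hw' : w ^ 2 = (B * z + c) ^ 2 +
          4 * (z ^ 2 - d) * (d * (z ^ 2 - d) + B * d + c * z) := by linear_combination -hw
      have e1 := hroot z w hw'
      have e2 := hroot z (-w) (by rw [neg_sq, hw'])
      have : 2 * w = 0 := by linear_combination e2 - e1
      apply hzero z
      rw [← hw', (mul_eq_zero.1 this).resolve_left h2]
      ring
    by_cases hq : 7 ≤ Fintype.card F
    · obtain ⟨k, s, e3, e2, e1, e0⟩ :=
        quartic_eq_mul_sq_of_not_isSquare hodd hq (mul_ne_zero h4 hd0) hns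
      have ec : c = 2 * d * k := mul_left_cancel₀ h4 (by linear_combination e3)
      by_cases hk : k = 0
      · subst hk
        have hc : c = 0 := by rw [ec]; ring
        subst hc
        have e2' : B ^ 2 + 4 * B * d - 8 * d ^ 2 = 8 * d * s := by linear_combination e2
        have e0' : d * (d - B) = s ^ 2 := mul_left_cancel₀ (mul_ne_zero h4 hd0)
          (by linear_combination e0)
        have : B ^ 3 * (B + 8 * d) = 0 := by
          linear_combination (B ^ 2 + 4 * B * d - 8 * d ^ 2 + 8 * d * s) * e2' - 64 * d ^ 2 * e0'
        rcases mul_eq_zero.1 this with h | h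
        · exact Or.inl ⟨pow_eq_zero_iff (by norm_num) |>.1 h, rfl⟩
        · exact Or.inr ⟨by linear_combination h, rfl⟩
      · have hs : 2 * s = B - 2 * d := by
          refine mul_left_cancel₀ (mul_ne_zero (mul_ne_zero h4 hd0) hk) ?_
          rw [ec] at e1
          linear_combination -e1
        exfalso
        have hB : B ^ 2 = 4 * d * k ^ 2 := by linear_combination e2 + 4 * d * hs
        refine hd ⟨B / (2 * k), ?_⟩
        field_simp
        linear_combination -hB
    · obtain ⟨n, hn⟩ := id hodd
      have h1 := Fintype.one_lt_card (α := F)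
      have : Fintype.card F = 3 ∨ Fintype.card F = 5 := by omega
      rcases this with h | h
      · exact nonsplit_classification_of_ringEquiv (ZMod.ringEquivOfPrime F Nat.prime_three h)
          nonsplit_classification_zmod_three hd hinj
      · exact nonsplit_classification_of_ringEquiv (ZMod.ringEquivOfPrime F Nat.prime_five h)
          nonsplit_classification_zmod_five hd hinj

/-- The function `x - 8 d x / (x ^ 2 - d)` is injective for `d` a nonsquare. -/
lemma nonsplit_injective (hodd : Odd (Fintype.card F)) {d : F} (hd : ¬ IsSquare d) {x y : F}
    (h : (x ^ 2 - d) * (y ^ 2 - d) = -8 * d * (x * y + d)) : x = y := by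
  have h2 := two_ne_zero_of_odd_card hodd
  have h4 : (4 : F) ≠ 0 := by
    rw [show (4 : F) = 2 * 2 by norm_num]; exact mul_ne_zero h2 h2
  have hd0 : d ≠ 0 := by rintro rfl; exact hd IsSquare.zero
  have key : ∀ x y : F, (x ^ 2 - d) * (y ^ 2 - d) = -8 * d * (x * y + d) →
      x ^ 2 + 3 * d = 0 := by
    intro x y h
    by_contra hne
    refine hd ⟨(2 * y * (x ^ 2 - d) + 8 * d * x) / (2 * (x ^ 2 + 3 * d)), ?_⟩
    have hne' := mul_ne_zero h2 hne
    rw [div_mul_div_comm, eq_div_iff (mul_ne_zero hne' hne')]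
    linear_combination -4 * (x ^ 2 - d) * h
  have hx := key x y h
  have hy := key y x (by linear_combination h)
  by_contra hne
  have hxy : y = -x := by
    have : (x - y) * (x + y) = 0 := by linear_combination hx - hy
    linear_combination (mul_eq_zero.1 this).resolve_left (sub_ne_zero.2 hne)
  subst hxy
  have h48 : 3 * (4 * 2 * 2 * d ^ 2) = 0 := by linear_combination h - (x ^ 2 - 13 * d) * hx
  rcases mul_eq_zero.1 h48 with h3 | h3
  · have : x ^ 2 = 0 := by linear_combination hx - d * h3
    rw [pow_eq_zero_iff (by norm_num)] at this
    exact hne (by rw [this, neg_zero])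
  · simp [h4, h2, hd0] at h3

end NonsplitDenominator

section InjectivePairs

variable {F : Type} [Field F]

open scoped Classical in
/-- The point `[a : b]` of the projective line. -/
def ratioPoint (a b : F) : Option F := if b = 0 then none else some (a / b)

lemma ratioPoint_eq_iff {a b c d : F} (hab : a ≠ 0 ∨ b ≠ 0) (hcd : c ≠ 0 ∨ d ≠ 0) :
    ratioPoint a b = ratioPoint c d ↔ a * d = c * b := by
  unfold ratioPoint
  by_cases hb : b = 0 <;> by_cases hd : d = 0
  · simp [hb, hd]
  · have ha : a ≠ 0 := hab.resolve_right (not_not.2 hb)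
    simp [hb, hd, ha]
  · have hc : c ≠ 0 := hcd.resolve_right (not_not.2 hd)
    simp [hb, hd, hc]
  · simp [hb, hd, div_eq_div_iff]

/-- The pair `(f, g)` of polynomials of degree at most three induces an injective map
`[f : g]` on the rational points of the projective line. -/
def IsInjectivePair (f g : F[X]) : Prop :=
  (∀ x y : F, f.eval x * g.eval y = f.eval y * g.eval x → x = y) ∧
    ∀ x : F, f.coeff 3 * g.eval x ≠ f.eval x * g.coeff 3

lemma IsInjectivePair.symm {f g : F[X]} (h : IsInjectivePair f g) : IsInjectivePair g f :=
  ⟨fun x y hxy => h.1 x y (by linear_combination -hxy),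
    fun x hx => h.2 x (by linear_combination -hx)⟩

lemma IsInjectivePair.add_mul {f g : F[X]} (h : IsInjectivePair f g) (e : F) :
    IsInjectivePair (f + C e * g) g := by
  refine ⟨fun x y hxy => h.1 x y ?_, fun x hx => h.2 x ?_⟩
  · simp only [eval_add, eval_mul, eval_C] at hxy
    linear_combination hxy
  · simp only [eval_add, eval_mul, eval_C, coeff_add, coeff_C_mul] at hx
    linear_combination hx

lemma IsInjectivePair.of_mul_right {f g : F[X]} {e : F}
    (h : IsInjectivePair f (C e * g)) : IsInjectivePair f g := by
  refine ⟨fun x y hxy => h.1 x y ?_, fun x hx => h.2 x ?_⟩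
  · simp only [eval_mul, eval_C]
    linear_combination e * hxy
  · simp only [eval_mul, eval_C, coeff_C_mul]
    linear_combination e * hx

lemma ratEval_some (f g : F[X]) (x : F) :
    ratEval f g (some x) = ratioPoint (f.eval x) (g.eval x) := by
  by_cases h : g.eval x = 0 <;> simp [ratEval, ratioPoint, h]

lemma ratEval_none {f g : F[X]} (hdeg : max f.natDegree g.natDegree = 3) :
    ratEval f g none = ratioPoint (f.coeff 3) (g.coeff 3) := by
  rcases lt_trichotomy g.natDegree f.natDegree with h | h | h
  · have : g.coeff 3 = 0 := coeff_eq_zero_of_natDegree_lt (by omega)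
    simp [ratEval, ratioPoint, h, this]
  · have hf : f.natDegree = 3 := by omega
    have hg : g.natDegree = 3 := by omega
    have hg0 : g.coeff 3 ≠ 0 := by
      rw [← hg, coeff_natDegree, leadingCoeff_ne_zero]
      rintro rfl; simp at hg
    simp [ratEval, ratioPoint, leadingCoeff, hf, hg, hg0]
  · have hg : g.natDegree = 3 := by omega
    have hf0 : f.coeff 3 = 0 := coeff_eq_zero_of_natDegree_lt (by omega)
    have hg0 : g.coeff 3 ≠ 0 := by
      rw [← hg, coeff_natDegree, leadingCoeff_ne_zero]
      rintro rfl; simp at hg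
    simp [ratEval, ratioPoint, h, h.le, hf0, hg0]

lemma ratEval_injective_iff {f g : F[X]} (hco : IsCoprime f g)
    (hdeg : max f.natDegree g.natDegree = 3) :
    Function.Injective (ratEval f g) ↔ IsInjectivePair f g := by
  have hpt : ∀ x, f.eval x ≠ 0 ∨ g.eval x ≠ 0 := by
    intro x
    obtain ⟨a, b, hab⟩ := hco
    by_contra! h
    simpa [h.1, h.2] using congrArg (eval x) hab
  have hinf : f.coeff 3 ≠ 0 ∨ g.coeff 3 ≠ 0 := by
    have : f.natDegree = 3 ∨ g.natDegree = 3 := by omega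
    refine this.imp (fun h => ?_) (fun h => ?_) <;>
    · rw [← h, coeff_natDegree, leadingCoeff_ne_zero]
      rintro rfl; simp at h
  constructor
  · intro h
    refine ⟨fun x y hxy => ?_, fun x hx => ?_⟩
    · have := @h (some x) (some y) (by
        rw [ratEval_some, ratEval_some, ratioPoint_eq_iff (hpt x) (hpt y), hxy])
      exact Option.some_injective _ this
    · have := @h none (some x) (by
        rw [ratEval_some, ratEval_none hdeg, ratioPoint_eq_iff hinf (hpt x), hx])
      simp at this
  · rintro ⟨h1, h2⟩ (_ | x) (_ | y) hxy
    · rfl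
    · rw [ratEval_some, ratEval_none hdeg, ratioPoint_eq_iff hinf (hpt y)] at hxy
      exact absurd hxy (h2 y)
    · rw [ratEval_some, ratEval_none hdeg, ratioPoint_eq_iff (hpt x) hinf] at hxy
      exact absurd hxy.symm (h2 x)
    · rw [ratEval_some, ratEval_some, ratioPoint_eq_iff (hpt x) (hpt y)] at hxy
      rw [h1 x y hxy]

end InjectivePairs

section Counting

variable {F : Type} [Field F]

/-- Coprime monic pairs `(f, g)` with `deg f = 3 > deg g` which are injective on the projective
line. -/
def dominantPairs (F : Type) [Field F] : Set (F[X] × F[X]) :=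
  {p | p.1.Monic ∧ p.2.Monic ∧ IsCoprime p.1 p.2 ∧ p.1.natDegree = 3 ∧ p.2.natDegree < 3 ∧
    IsInjectivePair p.1 p.2}

lemma mem_permPairs_iff [Finite F] {p : F[X] × F[X]} :
    p ∈ permPairs F ↔ p.1.Monic ∧ p.2.Monic ∧ IsCoprime p.1 p.2 ∧
      max p.1.natDegree p.2.natDegree = 3 ∧ IsInjectivePair p.1 p.2 := by
  unfold permPairs
  rw [Set.mem_ofPred_eq, ← Finite.injective_iff_bijective]
  constructor
  · rintro ⟨h1, h2, h3, h4, h5⟩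
    exact ⟨h1, h2, h3, h4, (ratEval_injective_iff h3 h4).1 h5⟩
  · rintro ⟨h1, h2, h3, h4, h5⟩
    exact ⟨h1, h2, h3, h4, (ratEval_injective_iff h3 h4).2 h5⟩

/-- From a pair `(f, g)` and a scalar `e`, the pair `(f + e g, f)` spanning the same pencil. -/
def pencilPair (z : (F[X] × F[X]) × F) : F[X] × F[X] := (z.1.1 + C z.2 * z.1.2, z.1.1)

lemma permPairs_eq_union [Finite F] :
    permPairs F = (dominantPairs F ∪ Prod.swap '' dominantPairs F) ∪
      pencilPair '' (dominantPairs F ×ˢ {0}ᶜ) := by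
  ext ⟨f, g⟩
  rw [mem_permPairs_iff]
  constructor
  · rintro ⟨hf, hg, hco, hdeg, hinj⟩
    simp only at hf hg hco hdeg hinj
    rcases lt_trichotomy g.natDegree f.natDegree with h | h | h
    · exact Or.inl (Or.inl ⟨hf, hg, hco, by simp only; omega, by simp only; omega, hinj⟩)
    · right
      have hfd : f.natDegree = 3 := by omega
      have hgd : g.natDegree = 3 := by omega
      have hne : f - g ≠ 0 := by
        intro h0
        rw [sub_eq_zero.1 h0, isCoprime_self] at hco
        rw [natDegree_eq_zero_of_isUnit hco] at hgd
        omega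
      set e := (f - g).leadingCoeff with he
      have he0 : e ≠ 0 := leadingCoeff_ne_zero.2 hne
      have hfe : f = g + C e * (C e⁻¹ * (f - g)) := by
        rw [← mul_assoc, ← C_mul, mul_inv_cancel₀ he0, C_1]; ring
      have hdeg' : (f - g).natDegree < 3 := by
        have := degree_sub_lt_left (p := f) (q := g) (by
          rw [degree_eq_natDegree hf.ne_zero, degree_eq_natDegree hg.ne_zero, h]) hf.ne_zero
          (by rw [hf.leadingCoeff, hg.leadingCoeff])
        exact hfd ▸ natDegree_lt_natDegree hne this
      refine ⟨((g, C e⁻¹ * (f - g)), e), ⟨⟨hg, ?_, ?_, hgd, ?_, ?_⟩, he0⟩, ?_⟩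
      · rw [mul_comm]; exact monic_mul_leadingCoeff_inv hne
      · have hu : IsUnit (C e⁻¹ : F[X]) := isUnit_C.2 (isUnit_iff_ne_zero.2 (inv_ne_zero he0))
        rw [isCoprime_mul_unit_left_right hu]
        simpa [sub_eq_add_neg] using IsCoprime.add_mul_left_right hco.symm (-1)
      · simp only [natDegree_C_mul (inv_ne_zero he0), hdeg']
      · have : IsInjectivePair (f + C (-1) * g) g := hinj.add_mul (-1)
        have h3 := this.symm
        refine IsInjectivePair.of_mul_right (e := e) ?_
        rw [← mul_assoc, ← C_mul, mul_inv_cancel₀ he0, C_1, one_mul]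
        convert h3 using 1
        simp [sub_eq_add_neg]
      · simp only [pencilPair]
        rw [← hfe]
    · exact Or.inl (Or.inr ⟨(g, f), ⟨hg, hf, hco.symm, by simp only; omega, by simp only; omega,
        hinj.symm⟩, rfl⟩)
  · rintro ((⟨hf, hg, hco, hfd, hgd, hinj⟩ | ⟨⟨a, b⟩, ⟨hf, hg, hco, hfd, hgd, hinj⟩, hab⟩) |
      ⟨⟨⟨a, b⟩, e⟩, ⟨⟨hf, hg, hco, hfd, hgd, hinj⟩, he⟩, hab⟩)
    · exact ⟨hf, hg, hco, by simp only at *; omega, hinj⟩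
    · simp only [Prod.swap, Prod.mk.injEq] at hab
      obtain ⟨rfl, rfl⟩ := hab
      exact ⟨hg, hf, hco.symm, by simp only at *; omega, hinj.symm⟩
    · simp only [pencilPair, Prod.mk.injEq] at hab hf hg hco hfd hgd hinj he
      obtain ⟨rfl, rfl⟩ := hab
      have hlt : (C e * b).natDegree < a.natDegree := by
        rw [natDegree_C_mul he]; omega
      refine ⟨hf.add_of_left (degree_lt_degree hlt), hf, ?_, ?_, ?_⟩
      · have hu : IsUnit (C e : F[X]) := isUnit_C.2 (isUnit_iff_ne_zero.2 he)
        have : IsCoprime (C e * b) a := (isCoprime_mul_unit_left_left hu _ _).2 hco.symm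
        simpa [add_comm] using IsCoprime.add_mul_left_left this 1
      · simp only [natDegree_add_eq_left_of_natDegree_lt hlt, hfd, max_self]
      · -- `(b, a)` ~ `(e b, a)` ~ `(e b + a, a)`
        have h1 : IsInjectivePair a (C e * b) := by
          refine IsInjectivePair.of_mul_right (e := e⁻¹) ?_
          rwa [← mul_assoc, ← C_mul, inv_mul_cancel₀ he, C_1, one_mul]
        simpa [add_comm] using h1.symm.add_mul 1

lemma pencilPair_injOn : Set.InjOn (pencilPair (F := F)) (dominantPairs F ×ˢ {0}ᶜ) := by
  rintro ⟨⟨f, g⟩, e⟩ ⟨⟨-, hg, -⟩, -⟩ ⟨⟨f', g'⟩, e'⟩ ⟨⟨-, hg', -⟩, he'⟩ h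
  simp only [pencilPair, Prod.mk.injEq] at h hg hg'
  obtain ⟨h1, rfl⟩ := h
  have h2 : C e * g = C e' * g' := add_left_cancel h1
  have h3 : e = e' := by
    simpa [leadingCoeff_mul, hg.leadingCoeff, hg'.leadingCoeff] using congrArg leadingCoeff h2
  subst h3
  have h4 : (C e : F[X]) ≠ 0 := C_ne_zero.2 he'
  rw [mul_left_cancel₀ h4 h2]

lemma ncard_permPairs [Fintype F] (hfin : (dominantPairs F).Finite) :
    (permPairs F).ncard = (Fintype.card F + 1) * (dominantPairs F).ncard := by
  have hz : ({0}ᶜ : Set F).ncard = Fintype.card F - 1 := by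
    rw [Set.ncard_compl, Nat.card_eq_fintype_card, Set.ncard_singleton]
  have hpos := Fintype.card_pos (α := F)
  have hfin' := hfin.prod (Set.toFinite ({0}ᶜ : Set F))
  rw [permPairs_eq_union, Set.ncard_union_eq ?_ (hfin.union (hfin.image _)) (hfin'.image _),
    Set.ncard_union_eq ?_ hfin (hfin.image _), Set.ncard_image_of_injective _ Prod.swap_injective,
    pencilPair_injOn.ncard_image, Set.ncard_prod, hz]
  · obtain ⟨n, hn⟩ := Nat.exists_eq_succ_of_ne_zero hpos.ne'
    rw [hn]; simp; ring
  · rw [Set.disjoint_left]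
    rintro _ ⟨-, -, -, h1, h2, -⟩ ⟨⟨a, b⟩, ⟨-, -, -, h3, h4, -⟩, rfl⟩
    simp at *; omega
  · rw [Set.disjoint_left]
    rintro _ hl ⟨⟨⟨a, b⟩, e⟩, ⟨⟨-, -, -, h3, h4, -⟩, he⟩, rfl⟩
    have hlt : (C e * b).natDegree < a.natDegree := by
      rw [natDegree_C_mul he]; simp only at *; omega
    have := natDegree_add_eq_left_of_natDegree_lt hlt
    rcases hl with ⟨-, -, -, h1, h2, -⟩ | ⟨⟨c, d⟩, ⟨-, -, -, h1, h2, -⟩, h⟩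
    · simp only [pencilPair] at *; omega
    · simp only [pencilPair, Prod.swap, Prod.mk.injEq] at h
      obtain ⟨rfl, rfl⟩ := h
      simp only at *; omega

end Counting

section NormalForms

variable {F : Type} [Field F]

/-- The polynomial `X ^ 3 + a X ^ 2 + b X + c`. -/
def monicCubic (a b c : F) : F[X] := X ^ 3 + C a * X ^ 2 + C b * X + C c

/-- The polynomial `X ^ 2 + u X + v`. -/
def monicQuadratic (u v : F) : F[X] := X ^ 2 + C u * X + C v

lemma natDegree_monicCubic (a b c : F) : (monicCubic a b c).natDegree = 3 := by
  unfold monicCubic; compute_degree!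

lemma natDegree_monicQuadratic (u v : F) : (monicQuadratic u v).natDegree = 2 := by
  unfold monicQuadratic; compute_degree!

lemma monic_monicCubic (a b c : F) : (monicCubic a b c).Monic := by
  unfold monicCubic; monicity!

lemma monic_monicQuadratic (u v : F) : (monicQuadratic u v).Monic := by
  unfold monicQuadratic; monicity!

lemma eval_monicCubic (a b c x : F) :
    (monicCubic a b c).eval x = x ^ 3 + a * x ^ 2 + b * x + c := by
  simp [monicCubic]

lemma eval_monicQuadratic (u v x : F) : (monicQuadratic u v).eval x = x ^ 2 + u * x + v := by
  simp [monicQuadratic]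

lemma monicCubic_inj {a b c a' b' c' : F} :
    monicCubic a b c = monicCubic a' b' c' ↔ a = a' ∧ b = b' ∧ c = c' := by
  refine ⟨fun h => ⟨?_, ?_, ?_⟩, by rintro ⟨rfl, rfl, rfl⟩; rfl⟩
  · simpa [monicCubic, coeff_X, coeff_C] using congrArg (coeff · 2) h
  · simpa [monicCubic, coeff_X, coeff_C] using congrArg (coeff · 1) h
  · simpa [monicCubic, coeff_X, coeff_C] using congrArg (coeff · 0) h

lemma monicQuadratic_inj {u v u' v' : F} :
    monicQuadratic u v = monicQuadratic u' v' ↔ u = u' ∧ v = v' := by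
  refine ⟨fun h => ⟨?_, ?_⟩, by rintro ⟨rfl, rfl⟩; rfl⟩
  · simpa [monicQuadratic, coeff_X, coeff_C] using congrArg (coeff · 1) h
  · simpa [monicQuadratic, coeff_X, coeff_C] using congrArg (coeff · 0) h

lemma exists_eq_monicCubic {f : F[X]} (hf : f.Monic) (hd : f.natDegree = 3) :
    ∃ a b c, f = monicCubic a b c := by
  refine ⟨f.coeff 2, f.coeff 1, f.coeff 0, ?_⟩
  have h3 : f.coeff 3 = 1 := hd ▸ hf.coeff_natDegree
  conv_lhs => rw [f.as_sum_range_C_mul_X_pow, hd]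
  simp [Finset.sum_range_succ, h3, monicCubic]
  ring

lemma exists_eq_monicQuadratic {g : F[X]} (hg : g.Monic) (hd : g.natDegree = 2) :
    ∃ u v, g = monicQuadratic u v := by
  refine ⟨g.coeff 1, g.coeff 0, ?_⟩
  have h2 : g.coeff 2 = 1 := hd ▸ hg.coeff_natDegree
  conv_lhs => rw [g.as_sum_range_C_mul_X_pow, hd]
  simp [Finset.sum_range_succ, h2, monicQuadratic]
  ring

lemma isInjectivePair_iff_of_natDegree {f g : F[X]} (hf : f.Monic) (hfd : f.natDegree = 3)
    (hgd : g.natDegree < 3) :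
    IsInjectivePair f g ↔ (∀ x y : F, f.eval x * g.eval y = f.eval y * g.eval x → x = y) ∧
      ∀ x, g.eval x ≠ 0 := by
  have h3 : f.coeff 3 = 1 := hfd ▸ hf.coeff_natDegree
  simp [IsInjectivePair, h3, coeff_eq_zero_of_natDegree_lt hgd]

/-- Coefficients of the cubic polynomials inducing injective functions. -/
def injectiveCubics (F : Type) [Field F] : Set (F × F × F) :=
  {p | ∀ x y : F, x ^ 3 + p.1 * x ^ 2 + p.2.1 * x = y ^ 3 + p.1 * y ^ 2 + p.2.1 * y → x = y}

/-- The pair of a cubic polynomial with constant denominator. -/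
def polynomialPair (p : F × F × F) : F[X] × F[X] := (monicCubic p.1 p.2.1 p.2.2, 1)

/-- With `Y = X - r`, the pair `(Y ^ 3 - 9 d Y + t (Y ^ 2 - d), Y ^ 2 - d)`. -/
def nonsplitPair (p : F × F × F) : F[X] × F[X] :=
  (monicCubic (p.2.2 - 3 * p.1) (3 * p.1 ^ 2 - 9 * p.2.1 - 2 * p.1 * p.2.2)
    (-p.1 ^ 3 + 9 * p.2.1 * p.1 + p.2.2 * (p.1 ^ 2 - p.2.1)),
  monicQuadratic (-2 * p.1) (p.1 ^ 2 - p.2.1))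

lemma polynomialPair_injective : Function.Injective (polynomialPair (F := F)) := by
  rintro ⟨a, b, c⟩ ⟨a', b', c'⟩ h
  simp only [polynomialPair, Prod.mk.injEq, and_true] at h
  obtain ⟨rfl, rfl, rfl⟩ := monicCubic_inj.1 h
  rfl

lemma nonsplitPair_injective (h2 : (2 : F) ≠ 0) : Function.Injective (nonsplitPair (F := F)) := by
  rintro ⟨r, d, t⟩ ⟨r', d', t'⟩ h
  simp only [nonsplitPair, Prod.mk.injEq, monicCubic_inj, monicQuadratic_inj] at h
  obtain ⟨⟨h1, -, -⟩, h4, h5⟩ := h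
  have hr : r = r' := mul_left_cancel₀ (neg_ne_zero.2 h2) h4
  subst hr
  have hd : d = d' := by linear_combination -h5
  have ht : t = t' := by linear_combination h1
  rw [hd, ht]

lemma nonsplitPair_mem_dominantPairs [Fintype F] (hodd : Odd (Fintype.card F)) {p : F × F × F}
    (hd : ¬ IsSquare p.2.1) : nonsplitPair p ∈ dominantPairs F := by
  obtain ⟨r, d, t⟩ := p
  simp only at hd
  have h2 := two_ne_zero_of_odd_card hodd
  have hd0 : d ≠ 0 := by rintro rfl; exact hd IsSquare.zero
  refine ⟨monic_monicCubic _ _ _, monic_monicQuadratic _ _, ?_, natDegree_monicCubic _ _ _,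
    (natDegree_monicQuadratic _ _).trans_lt (by norm_num),
    (isInjectivePair_iff_of_natDegree (monic_monicCubic _ _ _) (natDegree_monicCubic _ _ _)
      ((natDegree_monicQuadratic _ _).trans_lt (by norm_num))).2 ⟨?_, ?_⟩⟩
  · have hu : (8 * d ^ 2 : F) ≠ 0 := by
      rw [show (8 : F) = 2 * 2 * 2 by norm_num]
      simp [h2, hd0]
    have hC : C (8 * d ^ 2)⁻¹ * (8 * C d ^ 2) = (1 : F[X]) := by
      rw [show (8 * C d ^ 2 : F[X]) = C (8 * d ^ 2) by simp only [C_mul, C_pow, map_ofNat],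
        ← C_mul, inv_mul_cancel₀ hu, C_1]
    refine ⟨C (8 * d ^ 2)⁻¹ * -(X - C r),
      C (8 * d ^ 2)⁻¹ * ((X - C r) * (X - C r + C t) - 8 * C d), ?_⟩
    rw [← hC]
    simp only [nonsplitPair, monicCubic, monicQuadratic, C_mul, C_pow, C_add, C_sub, C_neg,
      map_ofNat]
    ring
  · intro x y h
    simp only [eval_monicCubic, eval_monicQuadratic] at h
    by_contra hne
    have hne' : x - y ≠ 0 := sub_ne_zero.2 hne
    have := nonsplit_injective hodd hd (x := x - r) (y := y - r) (by
      refine mul_left_cancel₀ hne' ?_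
      linear_combination h)
    exact hne (sub_left_injective this)
  · intro x h
    simp only [eval_monicQuadratic] at h
    exact hd ⟨x - r, by linear_combination -h⟩

lemma polynomialPair_mem_dominantPairs {p : F × F × F} (hp : p ∈ injectiveCubics F) :
    polynomialPair p ∈ dominantPairs F := by
  obtain ⟨a, b, c⟩ := p
  refine ⟨monic_monicCubic _ _ _, monic_one, isCoprime_one_right, natDegree_monicCubic _ _ _,
    by simp [polynomialPair],
    (isInjectivePair_iff_of_natDegree (monic_monicCubic _ _ _) (natDegree_monicCubic _ _ _)
      (by simp [polynomialPair])).2 ⟨fun x y h => hp x y ?_, by simp [polynomialPair]⟩⟩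
  simp only [polynomialPair, eval_monicCubic, eval_one] at h
  linear_combination h

lemma dominantPairs_eq_union [Fintype F] (hodd : Odd (Fintype.card F)) :
    dominantPairs F = polynomialPair '' injectiveCubics F ∪
      nonsplitPair '' (Set.univ ×ˢ {d | ¬ IsSquare d} ×ˢ Set.univ) := by
  have h2 := two_ne_zero_of_odd_card hodd
  refine Set.Subset.antisymm ?_ (Set.union_subset ?_ ?_)
  · rintro ⟨f, g⟩ ⟨hf, hg, hco, hfd, hgd, hinj⟩
    simp only at hf hg hco hfd hgd hinj
    obtain ⟨hinj, hroot⟩ := (isInjectivePair_iff_of_natDegree hf hfd hgd).1 hinj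
    obtain ⟨a, b, c, rfl⟩ := exists_eq_monicCubic hf hfd
    have hcases : g.natDegree = 0 ∨ g.natDegree = 1 ∨ g.natDegree = 2 := by omega
    rcases hcases with h | h | h
    · left
      obtain rfl := hg.natDegree_eq_zero.1 h
      refine ⟨(a, b, c), fun x y hxy => hinj x y ?_, rfl⟩
      simp only [eval_monicCubic, eval_one] at hxy ⊢
      linear_combination hxy
    · obtain ⟨x, hx⟩ := exists_root_of_degree_eq_one (degree_eq_iff_natDegree_eq hg.ne_zero |>.2 h)
      exact absurd hx (hroot x)
    · right
      obtain ⟨u, v, rfl⟩ := exists_eq_monicQuadratic hg h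
      simp only [eval_monicQuadratic, eval_monicCubic] at hroot hinj
      obtain ⟨r, rfl⟩ : ∃ r, u = -2 * r := ⟨-u / 2, by field_simp⟩
      obtain ⟨d, rfl⟩ : ∃ d, v = r ^ 2 - d := ⟨r ^ 2 - v, by ring⟩
      obtain ⟨t, rfl⟩ : ∃ t, a = t - 3 * r := ⟨a + 3 * r, by ring⟩
      have hd : ¬ IsSquare d := by
        rintro ⟨s, rfl⟩
        exact hroot (r + s) (by ring)
      refine ⟨(r, d, t), by simpa using hd, ?_⟩
      have := nonsplit_classification hodd hd
        (B := 3 * r ^ 2 + 2 * (t - 3 * r) * r + b + d)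
        (c := r ^ 3 + (t - 3 * r) * r ^ 2 + b * r + c + t * d) (fun x y hxy => by
          refine add_right_cancel (hinj (x + r) (y + r) ?_)
          linear_combination (x - y) * hxy)
      rcases this with ⟨hB, hc⟩ | ⟨hB, hc⟩
      · exfalso
        have hdvd : monicQuadratic (-2 * r) (r ^ 2 - d) ∣ monicCubic (t - 3 * r) b c := by
          refine ⟨X - C r + C t, ?_⟩
          have hB' : b = -(3 * r ^ 2 + 2 * (t - 3 * r) * r + d) := by linear_combination hB
          have hc' : c = -(r ^ 3 + (t - 3 * r) * r ^ 2 + b * r + t * d) := by linear_combination hc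
          rw [hc', hB']
          simp only [monicCubic, monicQuadratic, C_mul, C_pow, C_add, C_sub, C_neg, map_ofNat]
          ring
        have := natDegree_eq_zero_of_isUnit (hco.symm.isUnit_of_dvd hdvd)
        omega
      · simp only [nonsplitPair, Prod.mk.injEq, and_true]
        refine monicCubic_inj.2 ⟨rfl, by linear_combination -hB, by linear_combination r * hB - hc⟩
  · rintro _ ⟨p, hp, rfl⟩
    exact polynomialPair_mem_dominantPairs hp
  · rintro _ ⟨p, ⟨-, hp, -⟩, rfl⟩
    exact nonsplitPair_mem_dominantPairs hodd hp

lemma finite_dominantPairs [Fintype F] (hodd : Odd (Fintype.card F)) :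
    (dominantPairs F).Finite := by
  rw [dominantPairs_eq_union hodd]
  exact ((Set.toFinite _).image _).union ((Set.toFinite _).image _)

lemma ncard_dominantPairs [Fintype F] (hodd : Odd (Fintype.card F)) :
    (dominantPairs F).ncard = (injectiveCubics F).ncard +
      Fintype.card F * ({d : F | ¬ IsSquare d}.ncard * Fintype.card F) := by
  rw [dominantPairs_eq_union hodd, Set.ncard_union_eq ?_ ((Set.toFinite _).image _)
    ((Set.toFinite _).image _), Set.ncard_image_of_injective _ polynomialPair_injective,
    Set.ncard_image_of_injective _ (nonsplitPair_injective (two_ne_zero_of_odd_card hodd)),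
    Set.ncard_prod, Set.ncard_prod, Set.ncard_univ, Nat.card_eq_fintype_card]
  rw [Set.disjoint_left]
  rintro _ ⟨p, -, rfl⟩ ⟨p', -, h⟩
  have := congrArg (fun z : F[X] × F[X] => z.2.natDegree) h
  simp [polynomialPair, nonsplitPair, natDegree_monicQuadratic] at this

lemma ncard_injectiveCubics_of_card_mod_three_eq_two [Fintype F] (hodd : Odd (Fintype.card F))
    (h : Fintype.card F % 3 = 2) : (injectiveCubics F).ncard = Fintype.card F ^ 2 := by
  have h3 : (3 : F) ≠ 0 := fun h0 => by
    have := three_eq_zero_iff_dvd_card.1 h0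
    omega
  have himg : injectiveCubics F = (fun p : F × F => (p.1, p.1 ^ 2 / 3, p.2)) '' Set.univ := by
    ext ⟨a, b, c⟩
    constructor
    · intro hp
      have := sq_eq_three_mul_of_cubic_injective hodd hp
      refine ⟨(a, c), trivial, ?_⟩
      simp only at this
      simp only [this, mul_div_cancel_left₀ _ h3]
    · rintro ⟨⟨a', c'⟩, -, heq⟩
      simp only [Prod.mk.injEq] at heq
      obtain ⟨rfl, rfl, rfl⟩ := heq
      intro x y hxy
      refine add_right_cancel (b := a' / 3) (cube_injective_of_card_mod_three h ?_)
      simp only at hxy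
      field_simp at hxy ⊢
      linear_combination 9 * hxy
  rw [himg, Set.ncard_image_of_injective, Set.ncard_univ, Nat.card_prod,
    Nat.card_eq_fintype_card, sq]
  rintro ⟨a, c⟩ ⟨a', c'⟩ h
  simp only [Prod.mk.injEq] at h ⊢
  exact ⟨h.1, h.2.2⟩

lemma ncard_injectiveCubics_of_card_mod_three_eq_one [Fintype F] (hodd : Odd (Fintype.card F))
    (h : Fintype.card F % 3 = 1) : (injectiveCubics F).ncard = 0 := by
  have h3 : (3 : F) ≠ 0 := fun h0 => by
    have := three_eq_zero_iff_dvd_card.1 h0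
    omega
  rw [Set.ncard_eq_zero, Set.eq_empty_iff_forall_notMem]
  rintro ⟨a, b, c⟩ hp
  have hab := sq_eq_three_mul_of_cubic_injective hodd hp
  obtain ⟨w, hw1, hw3⟩ := exists_cube_eq_one_of_card_mod_three h
  simp only at hab
  refine hw1 ?_
  have := hp (1 - a / 3) (w - a / 3) (by
    simp only
    have : b = a ^ 2 / 3 := by field_simp; linear_combination -hab
    rw [this]
    field_simp
    linear_combination -27 * hw3)
  exact (sub_left_injective this).symm

lemma ncard_injectiveCubics_of_three_dvd_card [Fintype F] (hodd : Odd (Fintype.card F))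
    (h : 3 ∣ Fintype.card F) : (injectiveCubics F).ncard =
      ({d : F | ¬ IsSquare d}.ncard + 1) * Fintype.card F := by
  have h3 : (3 : F) = 0 := three_eq_zero_iff_dvd_card.2 h
  have himg : injectiveCubics F = (fun p : F × F => (0, -p.1, p.2)) ''
      (insert 0 {d : F | ¬ IsSquare d} ×ˢ Set.univ) := by
    ext ⟨a, b, c⟩
    constructor
    · intro hp
      have ha : a = 0 := by
        have := sq_eq_three_mul_of_cubic_injective hodd hp
        rw [h3, zero_mul] at this
        exact pow_eq_zero_iff (by norm_num) |>.1 this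
      subst ha
      refine ⟨(-b, c), ⟨?_, trivial⟩, by simp⟩
      by_contra hb
      simp only [Set.mem_insert_iff, Set.mem_ofPred_eq, not_or, not_not] at hb
      obtain ⟨hb0, s, hs⟩ := hb
      have : s = 0 := hp s 0 (by simp only; linear_combination -s * hs)
      exact hb0 (by rw [hs, this, zero_mul])
    · rintro ⟨⟨b', c'⟩, ⟨hb, -⟩, heq⟩
      simp only [Prod.mk.injEq] at heq
      obtain ⟨rfl, rfl, rfl⟩ := heq
      intro x y hxy
      simp only at hxy hb
      by_contra hne
      have hne' : x - y ≠ 0 := sub_ne_zero.2 hne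
      have hsq : b' = (x - y) * (x - y) := by
        refine mul_left_cancel₀ hne' ?_
        linear_combination -hxy + (x ^ 2 * y - x * y ^ 2) * h3
      rcases hb with hb | hb
      · rw [hb] at hsq
        exact hne' (mul_self_eq_zero.1 hsq.symm)
      · exact hb ⟨_, hsq⟩
  rw [himg, Set.ncard_image_of_injective, Set.ncard_prod, Set.ncard_univ,
    Nat.card_eq_fintype_card, Set.ncard_insert_of_notMem (by simp)]
  rintro ⟨a, c⟩ ⟨a', c'⟩ h
  simpa using h

end NormalForms

theorem stmt_11 (F : Type) [Field F] [Fintype F] (hodd : Odd (Fintype.card F)) :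
    (¬ 3 ∣ Fintype.card F →
      (2 * (permPairs F).ncard : ℤ) =
        (Fintype.card F : ℤ) ^ 4 +
          2 * ((Fintype.card F : ℤ) % 3 - 1) * (Fintype.card F : ℤ) ^ 3 +
          (2 * ((Fintype.card F : ℤ) % 3) - 3) * (Fintype.card F : ℤ) ^ 2) ∧
    (3 ∣ Fintype.card F →
      (2 * (permPairs F).ncard : ℤ) =
        (Fintype.card F : ℤ) ^ 4 + (Fintype.card F : ℤ) ^ 3 +
          (Fintype.card F : ℤ) ^ 2 + (Fintype.card F : ℤ)) := by
  have hn := two_mul_card_nonsquares_add_one hodd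
  have hcard := ncard_permPairs (finite_dominantPairs hodd)
  rw [ncard_dominantPairs hodd] at hcard
  constructor
  · intro h3
    have hmod : Fintype.card F % 3 = 1 ∨ Fintype.card F % 3 = 2 := by omega
    rcases hmod with hmod | hmod
    · rw [ncard_injectiveCubics_of_card_mod_three_eq_one hodd hmod] at hcard
      have hmod' : (Fintype.card F : ℤ) % 3 = 1 := by omega
      rw [hmod', hcard, ← hn]
      push_cast
      ring
    · rw [ncard_injectiveCubics_of_card_mod_three_eq_two hodd hmod] at hcard
      have hmod' : (Fintype.card F : ℤ) % 3 = 2 := by omega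
      rw [hmod', hcard, ← hn]
      push_cast
      ring
  · intro h3
    rw [ncard_injectiveCubics_of_three_dvd_card hodd h3] at hcard
    rw [hcard, ← hn]
    push_cast
    ring

end
end

section
/- Let q = 2ⁿ for some positive integer n, and let φ ∈ F_q(x) be a permutation rational function of degree 3. Then φ is equivalent to a rational function of the form (x³ + a₂x² + a₁x)/(x² + x + b₀) for some a₁, a₂, b₀ ∈ F_q with Tr_{F_q/F_2}(b₀) = 1. -/
open Polynomial

noncomputable section

/-- Composition of rational functions: `(f/g) ∘ ψ = f(ψ)/g(ψ)`. -/
def rfComp {F : Type} [Field F] (φ ψ : RatFunc F) : RatFunc F :=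
  Polynomial.aeval ψ φ.num / Polynomial.aeval ψ φ.denom

/-- A Möbius transformation `(ax + b)/(cx + d)` with `ad - bc ≠ 0`. -/
def IsMobius {F : Type} [Field F] (m : RatFunc F) : Prop :=
  ∃ a b c d : F, a * d - b * c ≠ 0 ∧
    m = (RatFunc.C a * RatFunc.X + RatFunc.C b) / (RatFunc.C c * RatFunc.X + RatFunc.C d)

/-- Equivalence of rational functions: `φ ∼ ψ` iff `m₁ ∘ φ ∘ m₂ = ψ` for some
Möbius transformations `m₁, m₂`. -/
def RFEquiv {F : Type} [Field F] (φ ψ : RatFunc F) : Prop :=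
  ∃ m₁ m₂ : RatFunc F, IsMobius m₁ ∧ IsMobius m₂ ∧ rfComp m₁ (rfComp φ m₂) = ψ

/-- `trOne n x` says the absolute trace `x + x² + x⁴ + ⋯ + x^{2^{n-1}}` of `x ∈ F_{2^n}` is `1`. -/
def trOne {F : Type} [Field F] (n : ℕ) (x : F) : Prop :=
  ∑ i ∈ Finset.range n, x ^ 2 ^ i = 1

/-- The pairs `(f, g)` obtained from `(num φ, denom φ)` by an invertible linear change,
i.e. the ways to write `m ∘ φ` as a quotient `f / g` with `m` Möbius. -/
def IsPostPair {F : Type} [Field F] (φ : RatFunc F) (f g : F[X]) : Prop :=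
  ∃ a b c d : F, a * d - b * c ≠ 0 ∧
    f = C a * φ.num + C b * φ.denom ∧ g = C c * φ.num + C d * φ.denom

lemma ratFunc_linear_ne_zero {F : Type} [Field F] {c d : F} (h : c ≠ 0 ∨ d ≠ 0) :
    RatFunc.C c * RatFunc.X + RatFunc.C d ≠ 0 := by
  have e : RatFunc.C c * RatFunc.X + RatFunc.C d
      = algebraMap F[X] (RatFunc F) (C c * X + C d) := by
    simp [RatFunc.algebraMap_C, RatFunc.algebraMap_X]
  rw [e, Ne, FaithfulSMul.algebraMap_eq_zero_iff]
  intro h0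
  have h1 := congrArg (fun p => coeff p 1) h0
  have h2 := congrArg (fun p => coeff p 0) h0
  simp at h1 h2
  tauto

lemma ne_zero_or_ne_zero_of_det {F : Type} [Field F] {a b c d : F} (h : a * d - b * c ≠ 0) :
    c ≠ 0 ∨ d ≠ 0 := by
  by_contra! hc
  simp [hc.1, hc.2] at h

lemma IsMobius.aeval_ne_zero {F : Type} [Field F] {m : RatFunc F} (hm : IsMobius m)
    {p : F[X]} (hp : p ≠ 0) : aeval m p ≠ 0 := by
  have ht : Transcendental F m := by
    apply RatFunc.transcendental_of_ne_C
    rintro ⟨k, hk⟩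
    obtain ⟨a, b, c, d, hdet, rfl⟩ := hm
    rw [div_eq_iff (ratFunc_linear_ne_zero (ne_zero_or_ne_zero_of_det hdet))] at hk
    have e : RatFunc.C (a - k * c) * RatFunc.X + RatFunc.C (b - k * d) = 0 := by
      simp only [map_sub, map_mul]
      linear_combination hk
    refine ratFunc_linear_ne_zero ?_ e
    by_contra! hc
    apply hdet
    linear_combination d * hc.1 - c * hc.2
  intro h0
  exact hp ((transcendental_iff.mp ht) p h0)

lemma rfComp_mobius {F : Type} [Field F] {a b c d : F} (hdet : a * d - b * c ≠ 0)
    {ψ : RatFunc F} (hψ : RatFunc.C c * ψ + RatFunc.C d ≠ 0) :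
    rfComp ((RatFunc.C a * RatFunc.X + RatFunc.C b) / (RatFunc.C c * RatFunc.X + RatFunc.C d)) ψ
      = (RatFunc.C a * ψ + RatFunc.C b) / (RatFunc.C c * ψ + RatFunc.C d) := by
  set m := (RatFunc.C a * RatFunc.X + RatFunc.C b) / (RatFunc.C c * RatFunc.X + RatFunc.C d)
    with hm
  have hcd : C c * X + C d ≠ (0 : F[X]) := by
    intro h0
    apply ratFunc_linear_ne_zero (ne_zero_or_ne_zero_of_det hdet)
    simpa [RatFunc.algebraMap_C, RatFunc.algebraMap_X] using
      congrArg (algebraMap F[X] (RatFunc F)) h0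
  have hm' : m = algebraMap F[X] (RatFunc F) (C a * X + C b) /
      algebraMap F[X] (RatFunc F) (C c * X + C d) := by
    simp [hm, RatFunc.algebraMap_C, RatFunc.algebraMap_X]
  have hmul : m.num * (C c * X + C d) = (C a * X + C b) * m.denom := by
    rw [RatFunc.num_mul_eq_mul_denom_iff hcd, hm']
  have hdvd : m.denom ∣ C c * X + C d := by
    rw [hm']
    exact RatFunc.denom_div_dvd _ _
  have hev (u v : F) : aeval ψ (C u * X + C v) = RatFunc.C u * ψ + RatFunc.C v := by
    simp [RatFunc.algebraMap_eq_C]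
  have hden : aeval ψ m.denom ≠ 0 := by
    obtain ⟨r, hr⟩ := hdvd
    intro h0
    apply hψ
    rw [← hev, hr, map_mul, h0, zero_mul]
  rw [rfComp, div_eq_div_iff hden hψ, ← hev, ← hev, ← map_mul, hmul, map_mul]

lemma rfEquiv_of_isPostPair {F : Type} [Field F] {φ ψ m : RatFunc F} {f g : F[X]}
    (hfg : IsPostPair φ f g) (hm : IsMobius m) {a b c d : F} (hdet : a * d - b * c ≠ 0)
    (hQ : RatFunc.C c * aeval m f + RatFunc.C d * aeval m g ≠ 0)
    (hψ : ψ * (RatFunc.C c * aeval m f + RatFunc.C d * aeval m g)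
      = RatFunc.C a * aeval m f + RatFunc.C b * aeval m g) :
    RFEquiv φ ψ := by
  obtain ⟨a', b', c', d', hdet', rfl, rfl⟩ := hfg
  have hG : aeval m φ.denom ≠ 0 := hm.aeval_ne_zero φ.denom_ne_zero
  have hdet'' : (a * a' + b * c') * (c * b' + d * d')
      - (a * b' + b * d') * (c * a' + d * c') ≠ 0 := by
    convert mul_ne_zero hdet hdet' using 1
    ring
  simp only [map_add, map_mul, aeval_C, RatFunc.algebraMap_eq_C] at hQ hψ
  refine ⟨_, m, ⟨_, _, _, _, hdet'', rfl⟩, hm, ?_⟩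
  have hden : RatFunc.C (c * a' + d * c') * rfComp φ m + RatFunc.C (c * b' + d * d') ≠ 0 := by
    intro h0
    apply hQ
    rw [rfComp] at h0
    field_simp at h0
    simp only [map_add, map_mul] at h0
    linear_combination h0
  rw [rfComp_mobius hdet'' hden, div_eq_iff hden, rfComp]
  field_simp
  simp only [map_add, map_mul]
  linear_combination -hψ

section Trace

variable {F : Type} [Field F] [Fintype F] {n : ℕ}

lemma charP_two_of_card (hq : Fintype.card F = 2 ^ n) : CharP F 2 := by
  have : Fact (Nat.Prime 2) := ⟨Nat.prime_two⟩
  exact charP_of_card_eq_prime_pow hq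

lemma exists_artinSchreier_of_sum_eq_zero (hn : 0 < n) (hq : Fintype.card F = 2 ^ n) {b : F}
    (hb : ∑ i ∈ Finset.range n, b ^ 2 ^ i = 0) : ∃ y : F, y ^ 2 + y = b := by
  have := charP_two_of_card hq
  classical
  let P : F →+ F :=
    { toFun := fun y => y ^ 2 + y
      map_zero' := by simp
      map_add' := fun x y => by rw [CharTwo.add_sq]; ring }
  let T : F[X] := ∑ i ∈ Finset.range n, X ^ 2 ^ i
  have hTdeg : T.natDegree ≤ 2 ^ (n - 1) := by
    refine natDegree_sum_le_of_forall_le _ _ fun i hi => ?_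
    rw [natDegree_X_pow]
    exact Nat.pow_le_pow_right (by norm_num) (by have := Finset.mem_range.mp hi; omega)
  have hT0 : T ≠ 0 := by
    intro h0
    have h1 := congrArg (fun p => coeff p 1) h0
    obtain ⟨k, rfl⟩ := Nat.exists_eq_succ_of_ne_zero hn.ne'
    have h2 (i : ℕ) : ¬ (1 : ℕ) = 2 ^ (i + 1) := by
      have := Nat.one_lt_two_pow (Nat.succ_ne_zero i)
      exact this.ne
    simp [T, coeff_X_pow, Finset.sum_range_succ', h2] at h1
  have hTeval (y : F) : T.eval y = ∑ i ∈ Finset.range n, y ^ 2 ^ i := by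
    simp [T, eval_finsetSum]
  have hsub : (P.range : Set F) ⊆ (T.roots.toFinset : Set F) := by
    rintro _ ⟨y, rfl⟩
    simp only [Finset.mem_coe, Multiset.mem_toFinset, mem_roots hT0, IsRoot.def, hTeval]
    have h1 : ∀ i ∈ Finset.range n, (P y) ^ 2 ^ i = y ^ 2 ^ (i + 1) - y ^ 2 ^ i := by
      intro i _
      change (y ^ 2 + y) ^ 2 ^ i = _
      rw [add_pow_char_pow, ← pow_mul, ← pow_succ', CharTwo.sub_eq_add]
    rw [Finset.sum_congr rfl h1, Finset.sum_range_sub (fun i => y ^ 2 ^ i), ← hq,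
      FiniteField.pow_card]
    simp
  have hker : Nat.card P.ker ≤ 2 := by
    have hk : (P.ker : Set F) ⊆ (({0, 1} : Finset F) : Set F) := by
      intro y hy
      have hy' : y * (y + 1) = 0 := by
        have : y ^ 2 + y = 0 := hy
        linear_combination this
      rcases mul_eq_zero.mp hy' with h | h
      · simp [h]
      · simp [CharTwo.add_eq_zero.mp h]
    calc Nat.card P.ker = (P.ker : Set F).ncard := rfl
      _ ≤ (({0, 1} : Finset F) : Set F).ncard := Set.ncard_le_ncard hk
      _ ≤ 2 := by rw [Set.ncard_coe_finset]; exact Finset.card_le_two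
  have hcard := P.ker.card_mul_index
  rw [AddSubgroup.index_ker, Nat.card_eq_fintype_card (α := F), hq] at hcard
  have hrange : 2 ^ (n - 1) ≤ (P.range : Set F).ncard := by
    have e : (2 : ℕ) ^ n = 2 * 2 ^ (n - 1) := by rw [← pow_succ', Nat.sub_add_cancel hn]
    have h2 : Nat.card P.ker * Nat.card P.range ≤ 2 * Nat.card P.range :=
      Nat.mul_le_mul_right _ hker
    change _ ≤ Nat.card P.range
    omega
  have hroots : (T.roots.toFinset : Set F).ncard ≤ (P.range : Set F).ncard := by
    rw [Set.ncard_coe_finset]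
    exact (Multiset.toFinset_card_le _).trans ((card_roots' T).trans (hTdeg.trans hrange))
  have heq := Set.eq_of_subset_of_ncard_le hsub hroots
  have hbmem : b ∈ (P.range : Set F) := by
    rw [heq]
    simp [hT0, hTeval, hb]
  exact hbmem

lemma trOne_of_forall_ne_zero (hn : 0 < n) (hq : Fintype.card F = 2 ^ n) {b : F}
    (hb : ∀ y : F, y ^ 2 + y + b ≠ 0) : trOne n b := by
  have := charP_two_of_card hq
  set t := ∑ i ∈ Finset.range n, b ^ 2 ^ i with ht
  have hsq : t ^ 2 = t := by
    have h1 : t ^ 2 = ∑ i ∈ Finset.range n, b ^ 2 ^ (i + 1) := by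
      rw [ht, sum_pow_char]
      exact Finset.sum_congr rfl fun i _ => by rw [← pow_mul, ← pow_succ]
    have h2 : t ^ 2 - t = 0 := by
      rw [h1, ht, ← Finset.sum_sub_distrib, Finset.sum_range_sub (fun i => b ^ 2 ^ i), ← hq,
        FiniteField.pow_card]
      simp
    exact sub_eq_zero.mp h2
  have hmul : t * (t - 1) = 0 := by linear_combination hsq
  rcases mul_eq_zero.mp hmul with h | h
  · obtain ⟨y, hy⟩ := exists_artinSchreier_of_sum_eq_zero hn hq h
    exact absurd (by rw [hy, CharTwo.add_self_eq_zero]) (hb y)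
  · exact sub_eq_zero.mp h

end Trace

/-- The target form is reached from a quotient of a cubic by a quadratic without roots. -/
lemma exists_rfEquiv_of_natDegree_two {F : Type} [Field F] [Fintype F] {n : ℕ} (hn : 0 < n)
    (hq : Fintype.card F = 2 ^ n) {φ : RatFunc F} {f g : F[X]} (hfg : IsPostPair φ f g)
    (hf : f.natDegree = 3) (hg : g.natDegree = 2) (hroot : ∀ x, g.eval x ≠ 0) :
    ∃ a₁ a₂ b₀ : F, trOne n b₀ ∧
      RFEquiv φ (algebraMap F[X] (RatFunc F) (X ^ 3 + C a₂ * X ^ 2 + C a₁ * X) /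
        algebraMap F[X] (RatFunc F) (X ^ 2 + X + C b₀)) := by
  have hchar := charP_two_of_card hq
  have hfe := f.as_sum_range_C_mul_X_pow
  have hge := g.as_sum_range_C_mul_X_pow
  rw [hf] at hfe
  rw [hg] at hge
  have hf3 : f.coeff 3 ≠ 0 := by
    rw [← hf]
    exact leadingCoeff_ne_zero.mpr (by rintro rfl; simp at hf)
  have hg2 : g.coeff 2 ≠ 0 := by
    rw [← hg]
    exact leadingCoeff_ne_zero.mpr (by rintro rfl; simp at hg)
  simp only [Finset.sum_range_succ, Finset.sum_range_zero, zero_add, pow_zero, mul_one,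
    pow_one] at hfe hge
  generalize f.coeff 0 = f0 at *
  generalize f.coeff 1 = f1 at *
  generalize f.coeff 2 = f2 at *
  generalize f.coeff 3 = f3 at *
  generalize g.coeff 0 = g0 at *
  generalize g.coeff 1 = g1 at *
  generalize g.coeff 2 = g2 at *
  have hroot' (x : F) : g0 + g1 * x + g2 * x ^ 2 ≠ 0 := by
    simpa [hge] using hroot x
  have hg0 : g0 ≠ 0 := by simpa using hroot' 0
  have hg1 : g1 ≠ 0 := by
    rintro rfl
    obtain ⟨s, hs⟩ := (FiniteField.isSquare_of_char_two (ringChar.eq F 2) (g0 / g2))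
    apply hroot' s
    rw [pow_two, ← hs, zero_mul, add_zero, mul_div_cancel₀ _ hg2, CharTwo.add_self_eq_zero]
  have hα : g1 / g2 ≠ 0 := div_ne_zero hg1 hg2
  set α := g1 / g2 with hαdef
  set b₀ := g0 * g2 / g1 ^ 2 with hb₀
  have hb₀0 : b₀ ≠ 0 := by positivity
  have htr : trOne n b₀ := by
    apply trOne_of_forall_ne_zero hn hq
    intro y hy
    apply hroot' (α * y)
    have : g0 + g1 * (α * y) + g2 * (α * y) ^ 2 = g1 ^ 2 / g2 * (y ^ 2 + y + b₀) := by
      rw [hαdef, hb₀]; field_simp; ring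
    rw [this, hy, mul_zero]
  set β := -(f0 / (f3 * α ^ 3 * b₀)) with hβ
  refine ⟨f1 / (f3 * α ^ 2) + β, f2 / (f3 * α) + β, b₀, htr, ?_⟩
  have hm : IsMobius (algebraMap F[X] (RatFunc F) (C α * X)) :=
    ⟨α, 0, 0, 1, by simpa using hα, by simp [RatFunc.algebraMap_C, RatFunc.algebraMap_X]⟩
  have hd : algebraMap F[X] (RatFunc F) (X ^ 2 + X + C b₀) ≠ 0 := by
    rw [Ne, FaithfulSMul.algebraMap_eq_zero_iff]
    intro h0
    have := congrArg (fun p => coeff p 0) h0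
    simp [hb₀0] at this
  have hgm : C (g2 / g1 ^ 2) * aeval (C α * X) g = X ^ 2 + X + C b₀ := by
    have e1 : g2 / g1 ^ 2 * g0 = b₀ := by rw [hb₀]; field_simp
    have e2 : g2 / g1 ^ 2 * g1 * α = 1 := by rw [hαdef]; field_simp
    have e3 : g2 / g1 ^ 2 * g2 * α ^ 2 = 1 := by rw [hαdef]; field_simp
    have e1' := congrArg C e1
    have e2' := congrArg C e2
    have e3' := congrArg C e3
    rw [hge]
    simp only [map_add, map_mul, map_pow, aeval_C, aeval_X, map_one, algebraMap_eq] at e1' e2' e3' ⊢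
    linear_combination e1' + X * e2' + X ^ 2 * e3'
  have hfm : C (1 / (f3 * α ^ 3)) * aeval (C α * X) f + C β * (X ^ 2 + X + C b₀)
      = X ^ 3 + C (f2 / (f3 * α) + β) * X ^ 2 + C (f1 / (f3 * α ^ 2) + β) * X := by
    have e0 : 1 / (f3 * α ^ 3) * f0 + β * b₀ = 0 := by rw [hβ]; field_simp; ring
    have e1 : 1 / (f3 * α ^ 3) * f1 * α = f1 / (f3 * α ^ 2) := by field_simp
    have e2 : 1 / (f3 * α ^ 3) * f2 * α ^ 2 = f2 / (f3 * α) := by field_simp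
    have e3 : 1 / (f3 * α ^ 3) * f3 * α ^ 3 = 1 := by field_simp
    have e0' := congrArg C e0
    have e1' := congrArg C e1
    have e2' := congrArg C e2
    have e3' := congrArg C e3
    rw [hfe]
    simp only [map_add, map_mul, map_pow, aeval_C, aeval_X, map_one, map_zero, algebraMap_eq]
      at e0' e1' e2' e3' ⊢
    linear_combination e0' + X * e1' + X ^ 2 * e2' + X ^ 3 * e3'
  have hgm' : RatFunc.C (g2 / g1 ^ 2) * aeval (algebraMap F[X] (RatFunc F) (C α * X)) g
      = algebraMap F[X] (RatFunc F) (X ^ 2 + X + C b₀) := by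
    rw [← hgm, aeval_algebraMap_apply, map_mul, RatFunc.algebraMap_C]
  refine rfEquiv_of_isPostPair hfg hm (a := 1 / (f3 * α ^ 3)) (b := β * (g2 / g1 ^ 2))
    (c := 0) (d := g2 / g1 ^ 2) ?_ ?_ ?_
  · rw [mul_zero, sub_zero]
    exact mul_ne_zero (one_div_ne_zero (mul_ne_zero hf3 (pow_ne_zero 3 hα)))
      (div_ne_zero hg2 (pow_ne_zero 2 hg1))
  · rw [map_zero, zero_mul, zero_add, hgm']
    exact hd
  · rw [map_zero, zero_mul, zero_add, map_mul RatFunc.C β, mul_assoc, hgm',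
      div_mul_cancel₀ _ hd, ← hfm, aeval_algebraMap_apply, map_add, map_mul _ (C _),
      map_mul _ (C β), RatFunc.algebraMap_C, RatFunc.algebraMap_C]

/-- The target form is reached from a cubic polynomial injective on a field of even order. -/
lemma exists_rfEquiv_of_natDegree_zero {F : Type} [Field F] [Fintype F] {n : ℕ} (hn : 0 < n)
    (hq : Fintype.card F = 2 ^ n) {φ : RatFunc F} {f : F[X]} {k : F} (hk : k ≠ 0)
    (hfg : IsPostPair φ f (C k)) (hf : f.natDegree = 3)
    (hinj : Function.Injective fun x => f.eval x) :
    ∃ a₁ a₂ b₀ : F, trOne n b₀ ∧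
      RFEquiv φ (algebraMap F[X] (RatFunc F) (X ^ 3 + C a₂ * X ^ 2 + C a₁ * X) /
        algebraMap F[X] (RatFunc F) (X ^ 2 + X + C b₀)) := by
  have hchar := charP_two_of_card hq
  have h2 : (2 : F) = 0 := CharTwo.two_eq_zero
  have hfe := f.as_sum_range_C_mul_X_pow
  rw [hf] at hfe
  have hf3 : f.coeff 3 ≠ 0 := by
    rw [← hf]
    exact leadingCoeff_ne_zero.mpr (by rintro rfl; simp at hf)
  obtain ⟨p, hp⟩ : ∃ p, f.coeff 2 = f.coeff 3 * p := ⟨f.coeff 2 / f.coeff 3, by field_simp⟩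
  obtain ⟨s, hs⟩ := FiniteField.isSquare_of_char_two (ringChar.eq F 2)
    (f.coeff 1 / f.coeff 3 - p ^ 2)
  have hc1 : f.coeff 1 = f.coeff 3 * (p ^ 2 + s * s) := by
    rw [← hs]; field_simp; ring
  simp only [Finset.sum_range_succ, Finset.sum_range_zero, zero_add, pow_zero, mul_one,
    pow_one, hp, hc1] at hfe
  generalize f.coeff 0 = f0 at *
  generalize f.coeff 3 = f3 at *
  have hev (x : F) : f.eval x =
      f3 * ((x + p) ^ 3 + s ^ 2 * (x + p)) + (f0 - f3 * (p ^ 3 + s ^ 2 * p)) := by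
    rw [hfe]
    simp only [eval_add, eval_mul, eval_pow, eval_C, eval_X]
    linear_combination (-f3 * p * x ^ 2 - f3 * p ^ 2 * x) * h2
  have hs0 : s = 0 := by
    have : p + s = p := hinj (by
      simp only [hev]
      linear_combination f3 * (6 * p ^ 2 * s + 3 * p * s ^ 2 + s ^ 3) * h2)
    simpa using this
  subst hs0
  set e := f0 - f3 * p ^ 3 with he
  have hev' (x : F) : f.eval x = f3 * (x + p) ^ 3 + e := by
    rw [hev, he]; ring
  have htr : trOne n (1 : F) := by
    apply trOne_of_forall_ne_zero hn hq
    intro r hr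
    have hr3 : r - p = 1 - p := hinj (by
      simp only [hev', sub_add_cancel]
      linear_combination f3 * (r - 1) * hr)
    have hr1 : r = 1 := by linear_combination hr3
    rw [hr1] at hr
    exact one_ne_zero (by linear_combination hr - h2 : (1 : F) = 0)
  have hX : (RatFunc.X : RatFunc F) ≠ 0 := RatFunc.X_ne_zero
  have h2' : (2 : RatFunc F) = 0 := by
    rw [← map_ofNat (RatFunc.C : F →+* RatFunc F) 2, h2, map_zero]
  have hm : IsMobius ((RatFunc.C (p + 1) * RatFunc.X + RatFunc.C 1) /
      (RatFunc.C 1 * RatFunc.X + RatFunc.C (0 : F))) :=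
    ⟨p + 1, 1, 1, 0, by simp, rfl⟩
  have hpol : f = C f3 * (X + C p) ^ 3 + C e := by
    have h2p : (2 : F[X]) = 0 := by rw [← map_ofNat (C : F →+* F[X]) 2, h2, map_zero]
    rw [hfe, he]
    simp only [map_sub, map_add, map_mul, map_pow, map_zero]
    linear_combination (-C f3 * C p * X ^ 2 - C f3 * C p ^ 2 * X) * h2p
  have hfm : aeval ((RatFunc.C (p + 1) * RatFunc.X + RatFunc.C 1) /
      (RatFunc.C 1 * RatFunc.X + RatFunc.C (0 : F))) f
      = RatFunc.C f3 * ((RatFunc.X + 1) / RatFunc.X) ^ 3 + RatFunc.C e := by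
    rw [hpol]
    simp only [map_add, map_mul, map_pow, aeval_C, aeval_X, RatFunc.algebraMap_eq_C, map_one,
      map_zero, one_mul, add_zero]
    congr 3
    field_simp
    linear_combination RatFunc.C p * RatFunc.X * h2'
  have hd : (RatFunc.X : RatFunc F) ^ 2 + RatFunc.X + 1 ≠ 0 := by
    have e1 : (RatFunc.X : RatFunc F) ^ 2 + RatFunc.X + 1
        = algebraMap F[X] (RatFunc F) (X ^ 2 + X + 1) := by simp [RatFunc.algebraMap_X]
    rw [e1, Ne, FaithfulSMul.algebraMap_eq_zero_iff]
    intro h0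
    simpa using congrArg (fun p => coeff p 0) h0
  have hf3' : RatFunc.C f3 ≠ 0 := by simpa using hf3
  have hk' : RatFunc.C k ≠ 0 := by simpa using hk
  have hQ : RatFunc.C (1 / f3) * (RatFunc.C f3 * ((RatFunc.X + 1) / RatFunc.X) ^ 3 + RatFunc.C e)
      + RatFunc.C (-(e / f3 + 1) / k) * RatFunc.C k
      = (RatFunc.X ^ 2 + RatFunc.X + 1) / RatFunc.X ^ 3 := by
    simp only [map_add, map_div₀, map_neg, map_one]
    field_simp
    linear_combination RatFunc.C f3 * (RatFunc.X ^ 2 + RatFunc.X) * h2'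
  refine ⟨0, 0, 1, htr, rfEquiv_of_isPostPair hfg hm (a := 0) (b := 1 / k)
    (c := 1 / f3) (d := -(e / f3 + 1) / k) ?_ ?_ ?_⟩
  · rw [zero_mul, zero_sub]
    exact neg_ne_zero.mpr (mul_ne_zero (one_div_ne_zero hk) (one_div_ne_zero hf3))
  · rw [hfm, aeval_C, RatFunc.algebraMap_eq_C, hQ]
    exact div_ne_zero hd (pow_ne_zero 3 hX)
  · rw [hfm, aeval_C, RatFunc.algebraMap_eq_C, hQ]
    simp only [map_add, map_pow, map_one, map_zero, map_div₀, zero_mul, add_zero,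
      zero_add, RatFunc.algebraMap_X]
    rw [div_mul_div_cancel₀ hd, div_self (pow_ne_zero 3 hX), one_div_mul_cancel hk']

lemma exists_rfEquiv_of_isPostPair {F : Type} [Field F] [Fintype F] {n : ℕ} (hn : 0 < n)
    (hq : Fintype.card F = 2 ^ n) {φ : RatFunc F} {f g : F[X]}
    (hfg : IsPostPair φ f g) (hf : f.natDegree = 3) (hg : g.natDegree ≤ 2)
    (hroot : ∀ x, g.eval x ≠ 0)
    (hinj : ∀ x y, f.eval x * g.eval y = f.eval y * g.eval x → x = y) :
    ∃ a₁ a₂ b₀ : F, trOne n b₀ ∧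
      RFEquiv φ (algebraMap F[X] (RatFunc F) (X ^ 3 + C a₂ * X ^ 2 + C a₁ * X) /
        algebraMap F[X] (RatFunc F) (X ^ 2 + X + C b₀)) := by
  interval_cases hgd : g.natDegree
  · obtain ⟨k, rfl⟩ := natDegree_eq_zero.mp hgd
    refine exists_rfEquiv_of_natDegree_zero hn hq (by simpa using hroot 0) hfg hf fun x y hxy => ?_
    exact hinj x y (by simpa only [eval_C] using congrArg (· * k) hxy)
  · obtain ⟨x, hx⟩ := exists_root_of_degree_eq_one ((degree_eq_iff_natDegree_eq_of_pos one_pos).mpr hgd)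
    exact absurd hx (hroot x)
  · exact exists_rfEquiv_of_natDegree_two hn hq hfg hf hgd hroot

/-- Injectivity of `ratEval` on affine points, with denominators cleared. -/
lemma eq_of_ratEval_injective {F : Type} [Field F] {f g : F[X]} (hcop : IsCoprime f g)
    (h : Function.Injective (ratEval f g)) {x y : F}
    (hxy : f.eval x * g.eval y = f.eval y * g.eval x) : x = y := by
  have hne (z : F) (hz : g.eval z = 0) : f.eval z ≠ 0 := by
    intro hz'
    obtain ⟨u, v, huv⟩ := hcop
    simpa [hz, hz'] using congrArg (eval z) huv
  apply Option.some_injective _ (h _)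
  by_cases hx : g.eval x = 0
  · have hy : g.eval y = 0 := by simpa [hx, hne x hx] using hxy
    simp [ratEval, hx, hy]
  · have hy : g.eval y ≠ 0 := by
      intro hy
      rw [hy, mul_zero, eq_comm] at hxy
      exact mul_ne_zero (hne y hy) hx hxy
    simp only [ratEval, ne_eq, hx, not_false_eq_true, if_true, hy, Option.some.injEq]
    rwa [div_eq_div_iff hx hy]

theorem stmt_12 (F : Type) [Field F] [Fintype F] (n : ℕ) (hn : 0 < n)
    (hq : Fintype.card F = 2 ^ n) (φ : RatFunc F)
    (hdeg : max φ.num.natDegree φ.denom.natDegree = 3)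
    (hperm : Function.Bijective (ratEval φ.num φ.denom)) :
    ∃ a₁ a₂ b₀ : F, trOne n b₀ ∧
      RFEquiv φ (algebraMap F[X] (RatFunc F) (X ^ 3 + C a₂ * X ^ 2 + C a₁ * X) /
        algebraMap F[X] (RatFunc F) (X ^ 2 + X + C b₀)) := by
  have hcop := φ.isCoprime_num_denom
  have hcross (x y : F) := eq_of_ratEval_injective (x := x) (y := y) hcop hperm.injective
  have hinf (x : F) : ratEval φ.num φ.denom (some x) ≠ ratEval φ.num φ.denom none :=
    fun h => Option.some_ne_none x (hperm.injective h)
  simp only [ratEval] at hinf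
  rcases lt_trichotomy φ.num.natDegree φ.denom.natDegree with hlt | heq | hgt
  · rw [max_eq_right hlt.le] at hdeg
    refine exists_rfEquiv_of_isPostPair hn hq (f := φ.denom) (g := φ.num)
      ⟨0, 1, 1, 0, by simp, by simp, by simp⟩ hdeg (by omega) (fun x hx => ?_)
      fun x y hxy => hcross x y (by linear_combination -hxy)
    have hgx : φ.denom.eval x ≠ 0 := by
      intro hgx
      obtain ⟨u, v, huv⟩ := hcop
      simpa [hx, hgx] using congrArg (eval x) huv
    apply hinf x
    simp [hlt, hlt.le, hgx, hx]
  · rw [heq, max_self] at hdeg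
    have hlg : φ.denom.leadingCoeff ≠ 0 := leadingCoeff_ne_zero.mpr φ.denom_ne_zero
    set c := φ.num.leadingCoeff / φ.denom.leadingCoeff with hc
    refine exists_rfEquiv_of_isPostPair hn hq (f := φ.denom) (g := φ.num - C c * φ.denom)
      ⟨0, 1, 1, -c, by simp, by simp, by simp [sub_eq_add_neg]⟩ hdeg ?_ (fun x hx => ?_)
      fun x y hxy => hcross x y ?_
    · have h3 : (φ.num - C c * φ.denom).natDegree ≤ 3 :=
        (natDegree_sub_le _ _).trans
          (max_le (heq.trans hdeg).le ((natDegree_C_mul_le _ _).trans hdeg.le))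
      have hcoeff : (φ.num - C c * φ.denom).coeff 3 = 0 := by
        have e1 : φ.num.coeff 3 = φ.num.leadingCoeff := by rw [leadingCoeff, heq, hdeg]
        have e2 : φ.denom.coeff 3 = φ.denom.leadingCoeff := by rw [leadingCoeff, hdeg]
        rw [coeff_sub, coeff_C_mul, e1, e2, hc, div_mul_cancel₀ _ hlg, sub_self]
      exact natDegree_le_pred h3 hcoeff
    · simp only [eval_sub, eval_mul, eval_C] at hx
      have hgx : φ.denom.eval x ≠ 0 := by
        intro hgx
        rw [hgx, mul_zero, sub_zero] at hx
        obtain ⟨u, v, huv⟩ := hcop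
        simpa [hx, hgx] using congrArg (eval x) huv
      apply hinf x
      simp only [hgx, heq, ne_eq, not_false_eq_true, if_true, lt_irrefl, if_false,
        Option.some.injEq]
      rw [div_eq_iff hgx]
      linear_combination hx
    · simp only [eval_sub, eval_mul, eval_C] at hxy
      linear_combination -hxy
  · rw [max_eq_left hgt.le] at hdeg
    refine exists_rfEquiv_of_isPostPair hn hq (f := φ.num) (g := φ.denom)
      ⟨1, 0, 0, 1, by simp, by simp, by simp⟩ hdeg (by omega) (fun x hx => ?_) hcross
    apply hinf x
    simp [hgt, hx]

end
end

section
/- Let q = 2ⁿ for some positive integer n. Then any two permutation rational functions of degree 3 in F_q(x) are equivalent. -/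
open Polynomial

noncomputable section

section CharTwo

variable {F : Type} [Field F] [CharP F 2]

/-- The Artin–Schreier map `w ↦ w ^ 2 + w` in characteristic two. -/
def artinSchreier (F : Type) [Field F] [CharP F 2] : F →+ F where
  toFun w := w ^ 2 + w
  map_zero' := by simp
  map_add' x y := by rw [CharTwo.add_sq]; ring

lemma artinSchreier_apply (w : F) : artinSchreier F w = w ^ 2 + w := rfl

lemma artinSchreier_ker : ((artinSchreier F).ker : Set F) = {0, 1} := by
  ext w
  have h2 : (2 : F) = 0 := CharTwo.two_eq_zero
  simp only [SetLike.mem_coe, AddMonoidHom.mem_ker, artinSchreier_apply, Set.mem_insert_iff,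
    Set.mem_singleton_iff]
  constructor
  · intro h
    rcases mul_eq_zero.mp (show w * (w - 1) = 0 by linear_combination h - w * h2) with h | h
    · exact Or.inl h
    · exact Or.inr (sub_eq_zero.mp h)
  · rintro (rfl | rfl)
    · simp
    · linear_combination h2

lemma card_range_artinSchreier : Nat.card (artinSchreier F).range * 2 = Nat.card F := by
  have h := (artinSchreier F).ker.card_mul_index
  rw [AddSubgroup.index_ker] at h
  have hk : Nat.card (artinSchreier F).ker = 2 := by
    have : Nat.card ((artinSchreier F).ker : Set F) = 2 := by
      rw [artinSchreier_ker, Nat.card_coe_set_eq, Set.ncard_pair zero_ne_one]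
    exact this
  rw [← h, hk, mul_comm]

lemma index_range_artinSchreier [Finite F] : (artinSchreier F).range.index = 2 := by
  have h := (artinSchreier F).range.card_mul_index
  have h' := card_range_artinSchreier (F := F)
  rw [← h'] at h
  exact Nat.eq_of_mul_eq_mul_left Nat.card_pos h

lemma exists_sq_eq [Finite F] (u : F) : ∃ a, a ^ 2 = u := by
  obtain ⟨a, ha⟩ := FiniteField.isSquare_of_char_two (ringChar.eq F 2) u
  exact ⟨a, by rw [ha, sq]⟩

end CharTwo

/-- A binary quadratic form with three zeros on the projective line vanishes. -/
lemma coeffs_eq_zero_of_three_zeros {F : Type} [Field F] {p q r : F} {y₁ y₂ y₃ : Option F}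
    (h₁₂ : y₁ ≠ y₂) (h₁₃ : y₁ ≠ y₃) (h₂₃ : y₂ ≠ y₃)
    (h : ∀ y ∈ ({y₁, y₂, y₃} : Set (Option F)), y.elim p (fun x => p * x ^ 2 + q * x + r) = 0) :
    p = 0 ∧ q = 0 ∧ r = 0 := by
  have lin : ∀ {q r x y : F}, x ≠ y → q * x + r = 0 → q * y + r = 0 → q = 0 ∧ r = 0 := by
    intro q r x y hxy hx hy
    have hq : q = 0 := by
      have : q * (x - y) = 0 := by linear_combination hx - hy
      exact (mul_eq_zero.mp this).resolve_right (sub_ne_zero.mpr hxy)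
    exact ⟨hq, by simpa [hq] using hx⟩
  have aff : ∀ {x y : F}, p = 0 → x ≠ y → p * x ^ 2 + q * x + r = 0 → p * y ^ 2 + q * y + r = 0 →
      p = 0 ∧ q = 0 ∧ r = 0 := by
    intro x y hp hxy hx hy
    exact ⟨hp, lin hxy (by simpa [hp] using hx) (by simpa [hp] using hy)⟩
  have e₁ := h y₁ (by simp)
  have e₂ := h y₂ (by simp)
  have e₃ := h y₃ (by simp)
  rcases y₁ with _ | x <;> rcases y₂ with _ | y <;> rcases y₃ with _ | z <;>
    simp only [Option.elim, ne_eq, not_true_eq_false, Option.some.injEq] at e₁ e₂ e₃ h₁₂ h₁₃ h₂₃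
  · exact aff e₁ h₂₃ e₂ e₃
  · exact aff e₂ h₁₃ e₁ e₃
  · exact aff e₃ h₁₂ e₁ e₂
  · have k₁ : p * (x + y) + q = 0 := by
      have : (p * (x + y) + q) * (x - y) = 0 := by linear_combination e₁ - e₂
      exact (mul_eq_zero.mp this).resolve_right (sub_ne_zero.mpr h₁₂)
    have k₂ : p * (x + z) + q = 0 := by
      have : (p * (x + z) + q) * (x - z) = 0 := by linear_combination e₁ - e₃
      exact (mul_eq_zero.mp this).resolve_right (sub_ne_zero.mpr h₁₃)
    obtain ⟨hp, -⟩ := lin (q := p) (r := p * x + q) h₂₃ (by linear_combination k₁)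
      (by linear_combination k₂)
    obtain ⟨hq, hr⟩ := lin (q := q) (r := r) h₁₂ (by simpa [hp] using e₁) (by simpa [hp] using e₂)
    exact ⟨hp, hq, hr⟩

section CharTwo

variable {F : Type} [Field F] [CharP F 2] [Fintype F]

/-- If `x + (a²x + b² + a²c)/(x² + x + c)` is injective on a finite field of even order, with
`x² + x + c` having no roots, then it equals `x + 1/(x² + x + c)`. -/
lemma eq_zero_and_eq_one_of_injective {a b c : F} (hc : c ∉ (artinSchreier F).range)
    (hab : a ≠ 0 ∨ b ≠ 0)
    (hinj : ∀ x y : F, x ≠ y → (x ^ 2 + x + c) * (y ^ 2 + y + c) + a ^ 2 * x * y + a ^ 2 * c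
      + (b ^ 2 + a ^ 2 * c) * (x + y + 1) ≠ 0) :
    a = 0 ∧ b = 1 := by
  classical
  have h2 : (2 : F) = 0 := CharTwo.two_eq_zero
  have hG : ∀ x : F, x ^ 2 + x + c ≠ 0 := fun x hx =>
    hc ⟨x, by rw [artinSchreier_apply]; linear_combination hx - c * h2⟩
  set H : F → F := fun y => y ^ 2 + (1 + a) * y + c + b with hH
  set B : F → F := fun y => y ^ 2 + y + c + a ^ 2 * y + b ^ 2 + a ^ 2 * c with hB
  have key₁ : ∀ y, B y = 0 → H y = 0 := by
    intro y hy
    obtain ⟨x, hx⟩ := exists_sq_eq ((c * (y ^ 2 + y + c) + a ^ 2 * c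
      + (b ^ 2 + a ^ 2 * c) * (y + 1)) / (y ^ 2 + y + c))
    rw [eq_div_iff (hG y)] at hx
    have hxy : x = y := by
      by_contra hne
      refine hinj x y hne ?_
      simp only [hB] at hy
      linear_combination hx + x * hy + h2 * (c * (y ^ 2 + y + c) + a ^ 2 * c
        + (b ^ 2 + a ^ 2 * c) * (y + 1))
    subst hxy
    have : (H x) ^ 2 = 0 := by
      simp only [hB] at hy
      simp only [hH]
      grind
    exact pow_eq_zero_iff (two_ne_zero) |>.mp this
  have key₂ : ∀ y, H y = 0 → B y = 0 := by
    intro y hy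
    by_contra hne
    refine hinj (y + B y / (y ^ 2 + y + c)) y ?_ ?_
    · simpa using ⟨hne, hG y⟩
    · obtain ⟨t, ht⟩ : ∃ t, t = B y / (y ^ 2 + y + c) := ⟨_, rfl⟩
      rw [← ht]
      rw [eq_div_iff (hG y)] at ht
      simp only [hB] at ht
      simp only [hH] at hy
      grind
  by_cases hroot : ∃ y, H y = 0
  · obtain ⟨y, hy⟩ := hroot
    have hBy := key₂ y hy
    have hy' : H (y + 1 + a ^ 2) = 0 := key₁ _ (by simp only [hB] at hBy ⊢; grind)
    have hprod : (1 + a) ^ 3 * a = 0 := by simp only [hH] at hy hy'; grind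
    simp only [hH] at hy
    simp only [hB] at hBy
    rcases mul_eq_zero.mp hprod with h | h
    · have ha : a = 1 := by
        have := pow_eq_zero_iff (three_ne_zero) |>.mp h
        linear_combination this - h2
      subst ha
      exact absurd ⟨b, by rw [artinSchreier_apply]; grind⟩ hc
    · refine ⟨h, ?_⟩
      have hb : b ≠ 0 := hab.resolve_left (not_not.mpr h)
      have : b * (b - 1) = 0 := by subst h; grind
      exact sub_eq_zero.mp ((mul_eq_zero.mp this).resolve_left hb)
  · push Not at hroot
    have hBroot : ∀ y, B y ≠ 0 := fun y hy => hroot y (key₁ y hy)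
    have ha : 1 + a ≠ 0 := by
      intro ha
      obtain ⟨y, hy⟩ := exists_sq_eq (c + b)
      refine hroot y ?_
      simp only [hH, ha, hy]
      linear_combination (c + b) * h2
    obtain ⟨d, hd⟩ : ∃ d, d * (1 + a) = 1 := ⟨(1 + a)⁻¹, inv_mul_cancel₀ ha⟩
    set N := b ^ 2 + a * b + a ^ 2 * c with hN
    have hN0 : N ≠ 0 := by
      intro h0
      by_cases ha0 : a = 0
      · exact hab.elim (fun h => h ha0) (fun h => h (by simpa [hN, ha0] using h0))
      · refine hc ⟨b / a, ?_⟩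
        rw [artinSchreier_apply]
        field_simp
        linear_combination h0 - a ^ 2 * c * h2
    set κ := d ^ 2 * N with hκ
    have hκ0 : κ ≠ 0 := mul_ne_zero (pow_ne_zero _ (left_ne_zero_of_mul_eq_one hd)) hN0
    have hε : d ^ 2 * (c + b) ∉ (artinSchreier F).range := by
      rintro ⟨w, hw⟩
      rw [artinSchreier_apply] at hw
      refine hroot ((1 + a) * w) ?_
      simp only [hH]
      grind
    have hadd := fun {x y : F} => AddSubgroup.add_mem_iff_of_index_two
      (index_range_artinSchreier (F := F)) (a := x) (b := y)
    have hκmem : κ ∈ (artinSchreier F).range := by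
      by_contra hcon
      obtain ⟨w, hw⟩ := hadd.mpr (iff_of_false hε hcon)
      rw [artinSchreier_apply] at hw
      refine hc ⟨w + b * d, ?_⟩
      rw [artinSchreier_apply]
      grind
    have hmem : ∀ y, κ * H y / B y ∈ (artinSchreier F).range := by
      intro y
      by_contra hcon
      obtain ⟨w, hw⟩ := hadd.mpr (iff_of_false hε hcon)
      rw [artinSchreier_apply, ← sub_eq_iff_eq_add', eq_div_iff (hBroot y)] at hw
      obtain ⟨x, hx⟩ : ∃ x, x * (y ^ 2 + y + c) = B y * w + d * (N * y + b * H y) :=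
        ⟨_, div_mul_cancel₀ _ (hG y)⟩
      have hzero : (x ^ 2 + x + c) * (y ^ 2 + y + c) + a ^ 2 * x * y + a ^ 2 * c
          + (b ^ 2 + a ^ 2 * c) * (x + y + 1) = 0 := by
        refine (mul_eq_zero.mp (?_ : _ * (y ^ 2 + y + c) = 0)).resolve_right (hG y)
        have hℓ : (y ^ 2 + y + c) * (c * (y ^ 2 + y + c) + a ^ 2 * c
            + (b ^ 2 + a ^ 2 * c) * (y + 1)) + (d * (N * y + b * H y)) ^ 2
            + B y * (d * (N * y + b * H y)) + κ * H y * B y + d ^ 2 * (c + b) * B y ^ 2 = 0 := by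
          refine (mul_eq_zero.mp (?_ : (1 + a) ^ 2 * _ = 0)).resolve_left (pow_ne_zero 2 ha)
          have hd' : d * a = 1 - d := by linear_combination hd
          simp only [hκ, hN, hB, hH]
          clear_value H B κ N
          clear hw hx hinj key₁ key₂ hroot hBroot hadd hκmem hε hcon hN0 hκ0 hG hκ hH hB hN
          grind
        have hA : ((x ^ 2 + x + c) * (y ^ 2 + y + c) + a ^ 2 * x * y + a ^ 2 * c
            + (b ^ 2 + a ^ 2 * c) * (x + y + 1)) * (y ^ 2 + y + c)
            = (x * (y ^ 2 + y + c)) ^ 2 + B y * (x * (y ^ 2 + y + c)) + (y ^ 2 + y + c) *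
            (c * (y ^ 2 + y + c) + a ^ 2 * c + (b ^ 2 + a ^ 2 * c) * (y + 1)) := by
          simp only [hB]
          ring
        rw [hA, hx]
        linear_combination hℓ + B y * hw
          + (B y * w * (d * (N * y + b * H y))) * h2
      have hxy : x ≠ y := by
        rintro rfl
        refine hroot x (pow_eq_zero_iff (two_ne_zero) |>.mp (?_ : H x ^ 2 = 0))
        rw [← hzero]
        simp only [hH]
        grind
      exact hinj x y hxy hzero
    let f : Option F → F := fun y => y.elim κ (fun y => κ * H y / B y)
    let S : Finset F := Finset.univ.filter (· ∈ (artinSchreier F).range)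
    have hcard : S.card * 2 < (Finset.univ : Finset (Option F)).card := by
      have h := card_range_artinSchreier (F := F)
      rw [Nat.card_eq_fintype_card (α := F)] at h
      have hS : S.card = Nat.card (artinSchreier F).range := by
        rw [Nat.card_eq_fintype_card, Fintype.card_subtype]
      rw [Finset.card_univ, Fintype.card_option, hS, h]
      exact Nat.lt_succ_self _
    obtain ⟨v, -, hv⟩ := Finset.exists_lt_card_fiber_of_mul_lt_card_of_maps_to (f := f) (t := S)
      (s := Finset.univ) (n := 2) (fun y _ => by
        rcases y with _ | y
        · simpa [S, f] using hκmem
        · simpa [S, f] using hmem y) hcard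
    obtain ⟨y₁, h₁, y₂, h₂, y₃, h₃, h₁₂, h₁₃, h₂₃⟩ := Finset.two_lt_card.mp hv
    have hfib : ∀ y, f y = v → y.elim (κ - v) (fun x => (κ - v) * x ^ 2
        + (κ * (1 + a) - v * (1 + a ^ 2)) * x + (κ * (c + b) - v * (c + b ^ 2 + a ^ 2 * c)))
        = 0 := by
      rintro (_ | y) hy
      · exact sub_eq_zero.mpr hy
      · have hy' := (div_eq_iff (hBroot y)).mp hy
        simp only [hB, hH] at hy'
        simp only [Option.elim]
        linear_combination hy'
    obtain ⟨k₁, k₂, k₃⟩ := coeffs_eq_zero_of_three_zeros h₁₂ h₁₃ h₂₃ (by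
      rintro y (rfl | rfl | rfl)
      · exact hfib _ (Finset.mem_filter.mp h₁).2
      · exact hfib _ (Finset.mem_filter.mp h₂).2
      · exact hfib _ (Finset.mem_filter.mp h₃).2)
    obtain rfl := sub_eq_zero.mp k₁
    have ha0 : a = 0 := by
      have : κ * (1 + a) * a = 0 := by linear_combination -k₂ + κ * a * h2
      exact (mul_eq_zero.mp this).resolve_left (mul_ne_zero hκ0 ha)
    refine ⟨ha0, ?_⟩
    have hb : b ≠ 0 := hab.resolve_left (not_not.mpr ha0)
    have : κ * b * (b - 1) = 0 := by rw [ha0] at k₃; linear_combination -k₃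
    exact sub_eq_zero.mp ((mul_eq_zero.mp this).resolve_left (mul_ne_zero hκ0 hb))

end CharTwo

section Mobius

variable {F K L : Type} [Field F] [Field K] [Algebra F K] [Field L] [Algebra F L]

/-- `v` is the image of `u` under a Möbius transformation with coefficients in `F`. -/
def MobiusRel (F : Type) {K : Type} [Field F] [Field K] [Algebra F K] (u v : K) : Prop :=
  ∃ a b c d : F, a * d - b * c ≠ 0 ∧ algebraMap F K c * u + algebraMap F K d ≠ 0 ∧
    v * (algebraMap F K c * u + algebraMap F K d) = algebraMap F K a * u + algebraMap F K b

lemma MobiusRel.symm {u v : K} (h : MobiusRel F u v) : MobiusRel F v u := by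
  obtain ⟨a, b, c, d, hdet, hne, h⟩ := h
  refine ⟨d, -b, -c, a, by rwa [neg_mul_neg, mul_comm d], fun h0 => ?_, ?_⟩
  · have : algebraMap F K (a * d - b * c) = 0 := by
      simp only [map_neg] at h0
      simp only [map_sub, map_mul]
      linear_combination h0 * (algebraMap F K c * u + algebraMap F K d) + algebraMap F K c * h
    exact hdet ((map_eq_zero _).mp this)
  · simp only [map_neg]
    linear_combination -h

lemma MobiusRel.trans {u v w : K} (h : MobiusRel F u v) (h' : MobiusRel F v w) :
    MobiusRel F u w := by
  obtain ⟨a, b, c, d, hdet, hne, h⟩ := h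
  obtain ⟨a', b', c', d', hdet', hne', h'⟩ := h'
  refine ⟨a' * a + b' * c, a' * b + b' * d, c' * a + d' * c, c' * b + d' * d, ?_, ?_, ?_⟩
  · have := mul_ne_zero hdet hdet'
    contrapose! this
    linear_combination this
  · have := mul_ne_zero hne hne'
    contrapose! this
    simp only [map_add, map_mul] at this
    linear_combination this + algebraMap F K c' * h
  · simp only [map_add, map_mul]
    linear_combination (algebraMap F K c * u + algebraMap F K d) * h'
      + (algebraMap F K a' - algebraMap F K c' * w) * h

lemma MobiusRel.map {u v : K} (h : MobiusRel F u v) (f : K →ₐ[F] L) :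
    MobiusRel F (f u) (f v) := by
  obtain ⟨a, b, c, d, hdet, hne, h⟩ := h
  refine ⟨a, b, c, d, hdet, ?_, ?_⟩
  · simpa using (map_ne_zero f).mpr hne
  · simpa using congrArg f h

lemma MobiusRel.affine (u : K) {s : F} (hs : s ≠ 0) (t : F) :
    MobiusRel F u (algebraMap F K s * u + algebraMap F K t) :=
  ⟨s, t, 0, 1, by simpa using hs, by simp, by simp⟩

lemma MobiusRel.refl (u : K) : MobiusRel F u u :=
  ⟨1, 0, 0, 1, by simp, by simp, by simp⟩

lemma MobiusRel.inv {u : K} (hu : u ≠ 0) : MobiusRel F u u⁻¹ :=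
  ⟨0, 1, 1, 0, by simp, by simpa using hu, by simp [hu]⟩

end Mobius

section RatFunc

variable {F : Type} [Field F]

lemma MobiusRel.ne_C {u v : RatFunc F} (h : MobiusRel F u v) (hu : ¬∃ k, u = RatFunc.C k) :
    ¬∃ k, v = RatFunc.C k := by
  rintro ⟨k, rfl⟩
  obtain ⟨a, b, c, d, -, hne, h⟩ := h.symm
  simp only [RatFunc.algebraMap_eq_C, ← map_mul, ← map_add] at hne h
  exact hu ⟨_, by rw [map_div₀]; exact (eq_div_iff hne).mpr h⟩

lemma RatFunc.X_ne_const : ¬∃ k : F, (RatFunc.X : RatFunc F) = RatFunc.C k := by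
  rintro ⟨k, hk⟩
  have := congrArg RatFunc.num hk
  rw [RatFunc.num_X, RatFunc.num_C] at this
  exact Polynomial.X_ne_C k this

lemma RatFunc.algHom_apply {L : Type} [Field L] [Algebra F L] (f : RatFunc F →ₐ[F] L)
    (φ : RatFunc F) : f φ = aeval (f RatFunc.X) φ.num / aeval (f RatFunc.X) φ.denom := by
  have h : ∀ p : F[X], aeval (f RatFunc.X) p = f (algebraMap F[X] (RatFunc F) p) := fun p => by
    rw [aeval_algHom_apply, ← RatFunc.algebraMap_X, aeval_algebraMap_apply, aeval_X_left_apply]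
  rw [h, h, ← map_div₀, RatFunc.num_div_denom]

lemma RatFunc.exists_algHom {m : RatFunc F} (hm : ¬∃ k, m = RatFunc.C k) :
    ∃ f : RatFunc F →ₐ[F] RatFunc F, f RatFunc.X = m ∧ ∀ φ, f φ = rfComp φ m := by
  have hinj : Function.Injective (aeval (R := F) m) :=
    transcendental_iff_injective.mp (RatFunc.transcendental_of_ne_C m hm)
  have key : ∀ φ, RatFunc.liftAlgHom (aeval (R := F) m)
      (nonZeroDivisors_le_comap_nonZeroDivisors_of_injective _ hinj) φ = rfComp φ m :=
    fun φ => RatFunc.liftAlgHom_apply _ _ φ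
  refine ⟨_, ?_, key⟩
  rw [key, rfComp, RatFunc.num_X, RatFunc.denom_X, aeval_X, map_one, div_one]

lemma MobiusRel.exists_algEquiv {m : RatFunc F} (h : MobiusRel F RatFunc.X m) :
    ∃ σ : RatFunc F ≃ₐ[F] RatFunc F, σ RatFunc.X = m := by
  obtain ⟨f, hf, -⟩ := RatFunc.exists_algHom (h.ne_C RatFunc.X_ne_const)
  obtain ⟨a, b, c, d, -, hne, h⟩ := h.symm
  obtain ⟨m', hm'⟩ : ∃ m', f m' = RatFunc.X := by
    refine ⟨(algebraMap F _ a * RatFunc.X + algebraMap F _ b) /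
      (algebraMap F _ c * RatFunc.X + algebraMap F _ d), ?_⟩
    simp only [map_div₀, map_add, map_mul, AlgHom.commutes, hf]
    rw [div_eq_iff hne, h]
  have hsurj : Function.Surjective f := fun r => ⟨rfComp r m', by
    rw [rfComp, map_div₀, ← aeval_algHom_apply, ← aeval_algHom_apply, hm']
    exact (RatFunc.algHom_apply (AlgHom.id F _) r).symm⟩
  exact ⟨AlgEquiv.ofBijective f ⟨f.injective, hsurj⟩, hf⟩

/-- Equivalence of rational functions, phrased through automorphisms of the function field. -/
def AutEquiv (φ ψ : RatFunc F) : Prop :=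
  ∃ σ : RatFunc F ≃ₐ[F] RatFunc F, MobiusRel F RatFunc.X (σ RatFunc.X) ∧ MobiusRel F (σ φ) ψ

lemma AutEquiv.symm {φ ψ : RatFunc F} (h : AutEquiv φ ψ) : AutEquiv ψ φ := by
  obtain ⟨σ, h₁, h₂⟩ := h
  have h₁' := (h₁.map (σ.symm : RatFunc F →ₐ[F] RatFunc F)).symm
  have h₂' := (h₂.map (σ.symm : RatFunc F →ₐ[F] RatFunc F)).symm
  exact ⟨σ.symm, by simpa using h₁', by simpa using h₂'⟩

lemma AutEquiv.trans {φ ψ χ : RatFunc F} (h : AutEquiv φ ψ) (h' : AutEquiv ψ χ) :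
    AutEquiv φ χ := by
  obtain ⟨σ, h₁, h₂⟩ := h
  obtain ⟨τ, h₁', h₂'⟩ := h'
  exact ⟨σ.trans τ, h₁'.trans (h₁.map (τ : RatFunc F →ₐ[F] RatFunc F)),
    (h₂.map (τ : RatFunc F →ₐ[F] RatFunc F)).trans h₂'⟩

lemma MobiusRel.autEquiv {φ ψ : RatFunc F} (h : MobiusRel F φ ψ) : AutEquiv φ ψ :=
  ⟨AlgEquiv.refl, MobiusRel.refl _, h⟩

/-- Changing the variable by a Möbius transformation `m` yields an equivalent function. -/
lemma autEquiv_of_mobiusRel {φ ψ m : RatFunc F} (hm : MobiusRel F RatFunc.X m)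
    (h : ∀ σ : RatFunc F ≃ₐ[F] RatFunc F, σ RatFunc.X = m → MobiusRel F (σ φ) ψ) :
    AutEquiv φ ψ := by
  obtain ⟨σ, hσ⟩ := hm.exists_algEquiv
  exact ⟨σ, hσ ▸ hm, h σ hσ⟩

lemma AutEquiv.rfEquiv {φ ψ : RatFunc F} (hφ : ¬∃ k, φ = RatFunc.C k) (h : AutEquiv φ ψ) :
    RFEquiv φ ψ := by
  obtain ⟨σ, ⟨a, b, c, d, hdet, hne, hX⟩, ⟨a', b', c', d', hdet', hne', hψ⟩⟩ := h
  simp only [RatFunc.algebraMap_eq_C] at hne hX hne' hψ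
  have hσ : rfComp φ (σ RatFunc.X) = σ φ :=
    (RatFunc.algHom_apply (σ : RatFunc F →ₐ[F] RatFunc F) φ).symm
  refine ⟨_, σ RatFunc.X, ⟨a', b', c', d', hdet', rfl⟩,
    ⟨a, b, c, d, hdet, (eq_div_iff hne).mpr hX⟩, ?_⟩
  have hnc : ¬∃ k, σ φ = RatFunc.C k := fun ⟨k, hk⟩ => hφ ⟨k, σ.injective (by
    rw [hk, ← RatFunc.algebraMap_eq_C, AlgEquiv.commutes])⟩
  obtain ⟨f, hf, hf'⟩ := RatFunc.exists_algHom hnc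
  rw [hσ, ← hf']
  simp only [← RatFunc.algebraMap_eq_C, map_div₀, map_add, map_mul, AlgHom.commutes, hf]
  exact ((eq_div_iff hne').mpr hψ).symm

end RatFunc

section Cubic

variable {F : Type} [Field F]

lemma ratEval_some_eq_of_cross_eq {f g : F[X]} (hfg : IsCoprime f g) {x y : F}
    (h : f.eval x * g.eval y = f.eval y * g.eval x) :
    ratEval f g (some x) = ratEval f g (some y) := by
  have hne : ∀ z, g.eval z = 0 → f.eval z ≠ 0 := fun z hg hf => by
    obtain ⟨u, v, huv⟩ := hfg
    simpa [hg, hf] using congrArg (eval z) huv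
  by_cases hx : g.eval x = 0 <;> by_cases hy : g.eval y = 0
  · simp [ratEval, hx, hy]
  · exact absurd (by simpa [hx, hy] using h) (hne x hx)
  · exact absurd (by simpa [hx, hy, eq_comm] using h) (hne y hy)
  · simp only [ratEval, ne_eq, hx, hy, not_false_eq_true, if_true, Option.some.injEq]
    rwa [div_eq_div_iff hx hy]

/-- The fraction `f / g` has degree three, fixes `∞`, and is injective on `F ∪ {∞}`. -/
structure IsInjectiveCubic (f g : F[X]) : Prop where
  natDegree_num : f.natDegree = 3
  natDegree_denom_le : g.natDegree ≤ 2
  isCoprime : IsCoprime f g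
  eval_denom_ne_zero : ∀ x, g.eval x ≠ 0
  cross_ne : ∀ x y, x ≠ y → f.eval x * g.eval y ≠ f.eval y * g.eval x

lemma IsInjectiveCubic.coeff_three_ne_zero {f g : F[X]} (h : IsInjectiveCubic f g) :
    f.coeff 3 ≠ 0 := by
  have hf : f ≠ 0 := by
    rintro rfl
    simpa using h.natDegree_num
  simpa [leadingCoeff, h.natDegree_num] using leadingCoeff_ne_zero.mpr hf

lemma exists_isInjectiveCubic {φ : RatFunc F}
    (hd : max φ.num.natDegree φ.denom.natDegree = 3)
    (hinj : Function.Injective (ratEval φ.num φ.denom)) :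
    ∃ f g : F[X], IsInjectiveCubic f g ∧
      MobiusRel F φ (algebraMap F[X] (RatFunc F) f / algebraMap F[X] (RatFunc F) g) := by
  have hcop := RatFunc.isCoprime_num_denom φ
  have hcross : ∀ x y, x ≠ y → φ.num.eval x * φ.denom.eval y ≠ φ.num.eval y * φ.denom.eval x :=
    fun x y hxy h => hxy (Option.some.inj (hinj (ratEval_some_eq_of_cross_eq hcop h)))
  by_cases hlt : φ.denom.natDegree < 3
  · have hn : φ.num.natDegree = 3 := by omega
    refine ⟨φ.num, φ.denom, ⟨hn, by omega, hcop, fun x hx => ?_, hcross⟩, ?_⟩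
    · have : ratEval φ.num φ.denom (some x) = ratEval φ.num φ.denom none := by
        simp [ratEval, hx, hn, hlt]
      exact absurd (hinj this) (by simp)
    · rw [RatFunc.num_div_denom]
      exact MobiusRel.refl φ
  · have hden : φ.denom.natDegree = 3 := by omega
    have hnum : φ.num.natDegree ≤ 3 := by omega
    have hmonic : φ.denom.coeff 3 = 1 := by
      rw [← hden]; exact RatFunc.monic_denom φ
    obtain ⟨k, hk⟩ : ∃ k, φ.num.coeff 3 = k := ⟨_, rfl⟩
    have hinf : ratEval φ.num φ.denom none = some k := by
      rcases hnum.lt_or_eq with h | h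
      · rw [coeff_eq_zero_of_natDegree_lt h] at hk
        simp [ratEval, hden, h, h.not_gt, hk]
      · simp [ratEval, hden, h, leadingCoeff, hk, hmonic]
    have hroot : ∀ x, (φ.num - C k * φ.denom).eval x ≠ 0 := by
      intro x hx
      simp only [eval_sub, eval_mul, eval_C] at hx
      by_cases h0 : φ.denom.eval x = 0
      · obtain ⟨u, v, huv⟩ := hcop
        have hn0 : φ.num.eval x = 0 := by simpa [h0] using hx
        simpa [h0, hn0] using congrArg (eval x) huv
      · have : ratEval φ.num φ.denom (some x) = ratEval φ.num φ.denom none := by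
          rw [hinf]
          simp only [ratEval, ne_eq, h0, not_false_eq_true, if_true, Option.some.injEq]
          rw [div_eq_iff h0]
          exact sub_eq_zero.mp hx
        exact absurd (hinj this) (by simp)
    refine ⟨φ.denom, φ.num - C k * φ.denom, ⟨hden, ?_, ?_, hroot, ?_⟩, ?_⟩
    · refine natDegree_le_iff_coeff_eq_zero.mpr fun N hN => ?_
      rcases (Nat.succ_le_of_lt hN).eq_or_lt with rfl | h
      · simp [hk, hmonic]
      · simp only [Nat.succ_eq_add_one] at h
        rw [coeff_sub, coeff_C_mul, coeff_eq_zero_of_natDegree_lt (by omega),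
          coeff_eq_zero_of_natDegree_lt (by omega), mul_zero, sub_zero]
    · have := (IsCoprime.add_mul_right_right hcop.symm (-C k))
      rwa [neg_mul, ← sub_eq_add_neg] at this
    · intro x y hxy h
      simp only [eval_sub, eval_mul, eval_C] at h
      exact hcross x y hxy (by linear_combination -h)
    · have hg : algebraMap F[X] (RatFunc F) (φ.num - C k * φ.denom) ≠ 0 := by
        rw [map_ne_zero_iff _ (RatFunc.algebraMap_injective F)]
        intro h0
        exact hroot 0 (by rw [h0, eval_zero])
      have hden0 : algebraMap F[X] (RatFunc F) φ.denom ≠ 0 :=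
        RatFunc.algebraMap_ne_zero φ.denom_ne_zero
      have hφ : φ * algebraMap F[X] (RatFunc F) φ.denom = algebraMap F[X] (RatFunc F) φ.num := by
        nth_rewrite 1 [← RatFunc.num_div_denom φ]
        exact div_mul_cancel₀ _ hden0
      have hsub : algebraMap F[X] (RatFunc F) (φ.num - C k * φ.denom)
          = (φ - RatFunc.C k) * algebraMap F[X] (RatFunc F) φ.denom := by
        rw [map_sub, map_mul, RatFunc.algebraMap_C, sub_mul, hφ]
      have hφk := left_ne_zero_of_mul (hsub ▸ hg)
      refine ⟨0, 1, 1, -k, by simp, ?_, ?_⟩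
      · simpa [RatFunc.algebraMap_eq_C, ← sub_eq_add_neg] using hφk
      · rw [hsub]
        simp only [RatFunc.algebraMap_eq_C, map_one, map_neg, map_zero, one_mul, zero_mul, zero_add,
          ← sub_eq_add_neg]
        field_simp

lemma aeval_eq_of_natDegree_le_three {f : F[X]} (hf : f.natDegree ≤ 3) {K : Type} [Field K]
    [Algebra F K] (x : K) : aeval x f = algebraMap F K (f.coeff 3) * x ^ 3
      + algebraMap F K (f.coeff 2) * x ^ 2 + algebraMap F K (f.coeff 1) * x
      + algebraMap F K (f.coeff 0) := by
  rw [aeval_eq_sum_range' (Nat.lt_succ_of_le hf)]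
  simp only [Finset.sum_range_succ, Finset.sum_range_zero, Algebra.smul_def]
  ring

lemma algebraMap_eq_aeval_X (f : F[X]) :
    algebraMap F[X] (RatFunc F) f = aeval RatFunc.X f := by
  rw [← RatFunc.algebraMap_X, aeval_algebraMap_apply, aeval_X_left_apply]

/-- The rational function `x + 1/(x² + x + c)`. -/
def cubicForm (c : F) : RatFunc F :=
  RatFunc.X + 1 / (RatFunc.X ^ 2 + RatFunc.X + algebraMap F _ c)

lemma quadratic_ne_zero {m : RatFunc F} (hm : ¬∃ k, m = RatFunc.C k) (c : F) :
    m ^ 2 + m + algebraMap F _ c ≠ 0 := by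
  have := (transcendental_iff.mp (RatFunc.transcendental_of_ne_C m hm)) (X ^ 2 + X + C c)
  intro h
  have h0 := congrArg (fun p => coeff p 2) (this (by simpa using h))
  simp [coeff_X] at h0

section CharTwo

variable [CharP F 2]

instance : CharP (RatFunc F) 2 := charP_of_injective_algebraMap (algebraMap F _).injective 2

lemma autEquiv_cubicForm_add (c s : F) :
    AutEquiv (cubicForm c) (cubicForm (s ^ 2 + s + c)) := by
  refine autEquiv_of_mobiusRel (m := algebraMap F _ 1 * RatFunc.X + algebraMap F _ s)
    (MobiusRel.affine _ one_ne_zero s) fun σ hσ => ?_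
  have key : σ (cubicForm c) = cubicForm (s ^ 2 + s + c) + algebraMap F _ s := by
    simp only [cubicForm, map_add, map_div₀, map_one, map_pow, AlgEquiv.commutes, hσ, one_mul,
      CharTwo.add_sq]
    ring_nf
  have := (MobiusRel.affine (cubicForm (s ^ 2 + s + c)) one_ne_zero s).symm
  rw [key]
  simpa using this

lemma autEquiv_X_pow_three_cubicForm : AutEquiv (RatFunc.X ^ 3) (cubicForm (1 : F)) := by
  have h2 : (2 : RatFunc F) = 0 := CharTwo.two_eq_zero
  have hX : (RatFunc.X : RatFunc F) ≠ 0 := RatFunc.X_ne_zero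
  have hq := quadratic_ne_zero (RatFunc.X_ne_const (F := F)) 1
  rw [map_one] at hq
  refine autEquiv_of_mobiusRel (m := algebraMap F _ 1 * RatFunc.X⁻¹ + algebraMap F _ 1)
    ((MobiusRel.inv hX).trans (MobiusRel.affine _ one_ne_zero 1)) fun σ hσ => ?_
  refine ⟨1, 0, 1, 1, by simp, ?_, ?_⟩
  · rw [map_pow, hσ]
    simp only [map_one, one_mul]
    intro h
    field_simp at h
    exact hq (by linear_combination h - h2 * (RatFunc.X ^ 3 + RatFunc.X ^ 2 + RatFunc.X))
  · rw [map_pow, hσ]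
    simp only [cubicForm, map_one, one_mul, map_zero, add_zero]
    field_simp
    grind

lemma exists_autEquiv_cubicForm_of_natDegree_eq_zero [Finite F] {f g : F[X]}
    (h : IsInjectiveCubic f g) (hg : g.natDegree = 0) :
    ∃ c ∉ (artinSchreier F).range, AutEquiv (cubicForm c)
      (algebraMap F[X] (RatFunc F) f / algebraMap F[X] (RatFunc F) g) := by
  have h2 : (2 : F) = 0 := CharTwo.two_eq_zero
  obtain ⟨g₀, rfl⟩ := natDegree_eq_zero.mp hg
  have hg₀ : g₀ ≠ 0 := by simpa using h.eval_denom_ne_zero 0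
  have hf₃ := h.coeff_three_ne_zero
  obtain ⟨p, hp⟩ : ∃ p, f.coeff 2 = f.coeff 3 * p := ⟨_, (mul_div_cancel₀ _ hf₃).symm⟩
  obtain ⟨q, hq⟩ : ∃ q, f.coeff 1 = f.coeff 3 * q := ⟨_, (mul_div_cancel₀ _ hf₃).symm⟩
  obtain ⟨r, hr⟩ := exists_sq_eq (q + p ^ 2)
  have hev : ∀ x, f.eval x = f.coeff 3 * (x ^ 3 + p * x ^ 2 + q * x) + f.coeff 0 := fun x => by
    have := aeval_eq_of_natDegree_le_three h.natDegree_num.le x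
    simp only [coe_aeval_eq_eval, Algebra.algebraMap_self, RingHom.id_apply, hp, hq] at this
    rw [this]; ring
  have hinj : ∀ x y, x ≠ y → x ^ 3 + p * x ^ 2 + q * x ≠ y ^ 3 + p * y ^ 2 + q * y := by
    intro x y hxy he
    refine h.cross_ne x y hxy ?_
    rw [hev, hev, he, eval_C, eval_C]
  have hr0 : r = 0 := by
    by_contra hr0
    exact hinj (p + r) p (by simpa using hr0) (by grind)
  have hqp : q = p ^ 2 := by subst hr0; grind
  subst hqp
  refine ⟨1, ?_, (autEquiv_X_pow_three_cubicForm.symm).trans ?_⟩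
  · rintro ⟨w, hw⟩
    rw [artinSchreier_apply] at hw
    refine hinj (w + p) (1 + p) ?_ ?_
    · intro hw1
      have hw1 : w = 1 := by simpa using hw1
      subst hw1
      exact one_ne_zero (α := F) (by linear_combination h2 - hw)
    · grind
  · have h2' : (2 : RatFunc F) = 0 := CharTwo.two_eq_zero
    refine autEquiv_of_mobiusRel (m := algebraMap F _ 1 * RatFunc.X + algebraMap F _ p)
      (MobiusRel.affine _ one_ne_zero p) fun σ hσ => ?_
    have := MobiusRel.affine (σ (RatFunc.X ^ 3)) (div_ne_zero hf₃ hg₀)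
      ((f.coeff 0 - f.coeff 3 * p ^ 3) / g₀)
    convert this using 1
    have hg₀' : algebraMap F (RatFunc F) g₀ ≠ 0 := (_root_.map_ne_zero _).mpr hg₀
    rw [algebraMap_eq_aeval_X, algebraMap_eq_aeval_X,
      aeval_eq_of_natDegree_le_three h.natDegree_num.le, aeval_C, map_pow, hσ, hp, hq]
    simp only [map_mul, map_pow, map_div₀, map_sub, map_one]
    field_simp
    grind

lemma exists_autEquiv_cubicForm_of_natDegree_ne_zero [Fintype F] {f g : F[X]}
    (h : IsInjectiveCubic f g) (hg : g.natDegree ≠ 0) :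
    ∃ c ∉ (artinSchreier F).range, AutEquiv (cubicForm c)
      (algebraMap F[X] (RatFunc F) f / algebraMap F[X] (RatFunc F) g) := by
  have h2 : (2 : F) = 0 := CharTwo.two_eq_zero
  have hf₃ := h.coeff_three_ne_zero
  have hg3 : g.natDegree ≤ 3 := h.natDegree_denom_le.trans (by norm_num)
  have hg₃ : g.coeff 3 = 0 :=
    coeff_eq_zero_of_natDegree_lt (h.natDegree_denom_le.trans_lt (by norm_num))
  have hevg : ∀ x, g.eval x = g.coeff 2 * x ^ 2 + g.coeff 1 * x + g.coeff 0 := fun x => by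
    have := aeval_eq_of_natDegree_le_three hg3 x
    simp only [coe_aeval_eq_eval, Algebra.algebraMap_self, RingHom.id_apply, hg₃] at this
    rw [this]; ring
  have hevf : ∀ x, f.eval x = f.coeff 3 * x ^ 3 + f.coeff 2 * x ^ 2 + f.coeff 1 * x
      + f.coeff 0 := fun x => by
    simpa using aeval_eq_of_natDegree_le_three h.natDegree_num.le x
  have hlead : g.coeff g.natDegree ≠ 0 :=
    leadingCoeff_ne_zero.mpr (ne_zero_of_natDegree_gt (Nat.pos_of_ne_zero hg))
  have hg₂ : g.coeff 2 ≠ 0 := by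
    intro h0
    have hdeg : g.natDegree = 1 := by
      have := h.natDegree_denom_le
      have : g.natDegree ≠ 2 := fun h' => hlead (h' ▸ h0)
      omega
    rw [hdeg] at hlead
    refine h.eval_denom_ne_zero (-g.coeff 0 / g.coeff 1) ?_
    rw [hevg, h0]
    field_simp
    ring
  have hg₁ : g.coeff 1 ≠ 0 := by
    intro h0
    obtain ⟨x, hx⟩ := exists_sq_eq (g.coeff 0 / g.coeff 2)
    refine h.eval_denom_ne_zero x ?_
    rw [hevg, h0, hx]
    field_simp
    linear_combination g.coeff 0 * h2
  obtain ⟨s, hs⟩ : ∃ s, g.coeff 1 = g.coeff 2 * s := ⟨_, (mul_div_cancel₀ _ hg₂).symm⟩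
  have hs0 : s ≠ 0 := right_ne_zero_of_mul (hs ▸ hg₁)
  obtain ⟨c, hc⟩ : ∃ c, g.coeff 0 = g.coeff 2 * s ^ 2 * c :=
    ⟨_, (mul_div_cancel₀ _ (mul_ne_zero hg₂ (pow_ne_zero 2 hs0))).symm⟩
  obtain ⟨l, hl⟩ : ∃ l, f.coeff 2 = f.coeff 3 * s * (l + 1) :=
    ⟨f.coeff 2 / (f.coeff 3 * s) - 1, by field_simp; ring⟩
  obtain ⟨a, ha⟩ : ∃ a, a ^ 2 = f.coeff 1 / (f.coeff 3 * s ^ 2) - (c + l) := exists_sq_eq _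
  obtain ⟨b, hb⟩ : ∃ b, b ^ 2 = f.coeff 0 / (f.coeff 3 * s ^ 3) - (l * c + a ^ 2 * c) :=
    exists_sq_eq _
  replace ha : f.coeff 1 = f.coeff 3 * s ^ 2 * (a ^ 2 + (c + l)) := by
    rw [ha]; field_simp; ring
  replace hb : f.coeff 0 = f.coeff 3 * s ^ 3 * (b ^ 2 + (l * c + a ^ 2 * c)) := by
    rw [hb]; field_simp; ring
  have hcR : c ∉ (artinSchreier F).range := by
    rintro ⟨w, hw⟩
    rw [artinSchreier_apply] at hw
    refine h.eval_denom_ne_zero (s * w) ?_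
    rw [hevg, hs, hc]
    linear_combination g.coeff 2 * s ^ 2 * (hw + c * h2)
  have hab : a ≠ 0 ∨ b ≠ 0 := by
    by_contra! hcon
    obtain ⟨rfl, rfl⟩ := hcon
    have hdvd : g ∣ f := by
      refine ⟨C (f.coeff 3 / g.coeff 2) * (X + C (s * l)), ?_⟩
      have hg₂' : algebraMap F (RatFunc F) (g.coeff 2) ≠ 0 := (_root_.map_ne_zero _).mpr hg₂
      apply RatFunc.algebraMap_injective F
      rw [algebraMap_eq_aeval_X, algebraMap_eq_aeval_X, map_mul, map_mul, map_add, aeval_X, aeval_C,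
        aeval_C, aeval_eq_of_natDegree_le_three h.natDegree_num.le,
        aeval_eq_of_natDegree_le_three hg3, hl, ha, hb, hs, hc, hg₃]
      simp only [map_mul, map_pow, map_zero, map_add, map_one, map_div₀]
      field_simp
      ring
    have := natDegree_eq_zero_of_isUnit (h.isCoprime.isUnit_of_dvd' hdvd dvd_rfl)
    exact hg this
  obtain ⟨rfl, rfl⟩ := eq_zero_and_eq_one_of_injective hcR hab fun x y hxy h0 => by
    refine h.cross_ne (s * x) (s * y) (fun he => hxy (mul_left_cancel₀ hs0 he)) ?_
    rw [hevf, hevf, hevg, hevg, hl, ha, hb, hs, hc]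
    linear_combination f.coeff 3 * g.coeff 2 * s ^ 5 * (x - y) * h0
      + f.coeff 3 * g.coeff 2 * s ^ 5 * (-x * a ^ 2 * c + x * a ^ 2 * y ^ 2 - x * b ^ 2
        - x ^ 2 * a ^ 2 * c - x ^ 2 * a ^ 2 * y - x ^ 2 * b ^ 2 + a ^ 2 * c * y
        + a ^ 2 * c * y ^ 2 + b ^ 2 * y + b ^ 2 * y ^ 2) * h2
  refine ⟨c, hcR, ?_⟩
  have hs' : algebraMap F (RatFunc F) s ≠ 0 := (_root_.map_ne_zero _).mpr hs0
  have hg₂' : algebraMap F (RatFunc F) (g.coeff 2) ≠ 0 := (_root_.map_ne_zero _).mpr hg₂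
  have hm : MobiusRel F RatFunc.X (algebraMap F (RatFunc F) s⁻¹ * RatFunc.X + algebraMap F _ 0) :=
    MobiusRel.affine _ (inv_ne_zero hs0) 0
  refine autEquiv_of_mobiusRel hm fun σ hσ => ?_
  have hq := quadratic_ne_zero (hm.ne_C RatFunc.X_ne_const) c
  have := MobiusRel.affine (σ (cubicForm c))
    (div_ne_zero (mul_ne_zero hf₃ hs0) hg₂) (f.coeff 3 * s * l / g.coeff 2)
  convert this using 1
  simp only [cubicForm, map_add, map_div₀, map_one, map_pow, AlgEquiv.commutes, hσ]
  obtain ⟨z, hz⟩ : ∃ z, algebraMap F (RatFunc F) s⁻¹ * RatFunc.X + algebraMap F _ 0 = z :=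
    ⟨_, rfl⟩
  have hX : RatFunc.X = algebraMap F (RatFunc F) s * z := by
    rw [← hz, map_inv₀, map_zero, add_zero, mul_inv_cancel_left₀ hs']
  rw [hz] at hq ⊢
  rw [algebraMap_eq_aeval_X, algebraMap_eq_aeval_X,
    aeval_eq_of_natDegree_le_three h.natDegree_num.le, aeval_eq_of_natDegree_le_three hg3,
    hX, hl, ha, hb, hs, hc, hg₃]
  have hden : algebraMap F (RatFunc F) 0 * (algebraMap F (RatFunc F) s * z) ^ 3
      + algebraMap F (RatFunc F) (g.coeff 2) * (algebraMap F (RatFunc F) s * z) ^ 2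
      + algebraMap F (RatFunc F) (g.coeff 2 * s) * (algebraMap F (RatFunc F) s * z)
      + algebraMap F (RatFunc F) (g.coeff 2 * s ^ 2 * c)
      = algebraMap F (RatFunc F) (g.coeff 2) * algebraMap F (RatFunc F) s ^ 2
        * (z ^ 2 + z + algebraMap F (RatFunc F) c) := by
    simp only [map_mul, map_pow, map_zero]
    ring
  rw [hden]
  generalize hD : z ^ 2 + z + algebraMap F (RatFunc F) c = D at hq ⊢
  simp only [map_mul, map_pow, map_zero, map_add, map_one]
  field_simp
  rw [← hD]
  ring

end CharTwo

end Cubic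

theorem stmt_14 (F : Type) [Field F] [Fintype F] (n : ℕ) (hn : 0 < n)
    (hq : Fintype.card F = 2 ^ n) (φ ψ : RatFunc F)
    (hφd : max φ.num.natDegree φ.denom.natDegree = 3)
    (hψd : max ψ.num.natDegree ψ.denom.natDegree = 3)
    (hφp : Function.Bijective (ratEval φ.num φ.denom))
    (hψp : Function.Bijective (ratEval ψ.num ψ.denom)) :
    RFEquiv φ ψ := by
  have h2 : (2 : F) = 0 := by
    have h := Nat.cast_card_eq_zero F
    rw [hq, Nat.cast_pow, Nat.cast_ofNat] at h
    exact (pow_eq_zero_iff hn.ne').mp h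
  have : CharP F 2 := CharTwo.of_one_ne_zero_of_two_eq_zero one_ne_zero h2
  have key : ∀ χ : RatFunc F, max χ.num.natDegree χ.denom.natDegree = 3 →
      Function.Injective (ratEval χ.num χ.denom) →
      ∃ c ∉ (artinSchreier F).range, AutEquiv (cubicForm c) χ := by
    intro χ hd hinj
    obtain ⟨f, g, h, hχ⟩ := exists_isInjectiveCubic hd hinj
    by_cases hg : g.natDegree = 0
    · obtain ⟨c, hc, hcχ⟩ := exists_autEquiv_cubicForm_of_natDegree_eq_zero h hg
      exact ⟨c, hc, hcχ.trans hχ.symm.autEquiv⟩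
    · obtain ⟨c, hc, hcχ⟩ := exists_autEquiv_cubicForm_of_natDegree_ne_zero h hg
      exact ⟨c, hc, hcχ.trans hχ.symm.autEquiv⟩
  obtain ⟨c, hc, hcφ⟩ := key φ hφd hφp.injective
  obtain ⟨c', hc', hcψ⟩ := key ψ hψd hψp.injective
  obtain ⟨s, hs⟩ := (AddSubgroup.add_mem_iff_of_index_two
    (index_range_artinSchreier (F := F))).mpr (iff_of_false hc' hc)
  have hcc : c' = s ^ 2 + s + c := by
    rw [artinSchreier_apply] at hs
    linear_combination -hs - c * h2
  subst hcc
  refine AutEquiv.rfEquiv ?_ ((hcφ.symm.trans (autEquiv_cubicForm_add c s)).trans hcψ)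
  rintro ⟨k, rfl⟩
  simp at hφd

end
end
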